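/- Finite first absolute moment of the stationary distribution in the second coordinate. Assume a₁ > 0, b₂ > 0, ∫_{{z₁>1}} z₁ n(dz) < ∞, and ∫_G |z₂|² n(dz) < ∞, and let π be the unique stationary (invariant) distribution of (P_t)_{t≥0}. Then ∫_G |y₂| π(dy) < ∞. -/

import Mathlib

open MeasureTheory Filter Set Topology
open scoped ENNReal Classical

noncomputable section

namespace AffinePaper

/-- Total variation distance between two measures:
`‖μ - ν‖_var = sup {|∫ f dμ - ∫ f dν| : f measurable, |f| ≤ 1}`. -/
def tvDist {α : Type*} [MeasurableSpace α] (μ ν : Measure α) : ℝ :=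
  ⨆ f : {f : α → ℝ // Measurable f ∧ ∀ x, |f x| ≤ 1},
    |(∫ x, f.1 x ∂μ) - ∫ x, f.1 x ∂ν|

/-- Translate of a measure on `ℝ` by `a`, i.e. `δ_a * σ`. -/
def translate (a : ℝ) (σ : Measure ℝ) : Measure ℝ := Measure.map (fun x => x + a) σ

/-- The function `φ` of the affine process. -/
def phi (a₁ b₁ α₁₁ α₁₂ α₂₁ α₂₂ : ℝ) (m : Measure (ℝ × ℝ)) (u : ℂ × ℂ) : ℂ :=
  -(a₁ : ℂ) * u.1 - (b₁ : ℂ) * u.2 + ((α₁₁ : ℂ) + (α₁₂ : ℂ)) * u.1 ^ 2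
    + 2 * ((Real.sqrt (α₁₁ * α₂₁) : ℂ) + (Real.sqrt (α₁₂ * α₂₂) : ℂ)) * u.1 * u.2
    + ((α₂₁ : ℂ) + (α₂₂ : ℂ)) * u.2 ^ 2
    + ∫ z : ℝ × ℝ,
        (Complex.exp (u.1 * (z.1 : ℂ) + u.2 * (z.2 : ℂ)) - 1
          - (u.1 * (z.1 : ℂ) + u.2 * (z.2 : ℂ))) ∂m

/-- The function `ψ` of the affine process. -/
def psi (a₂ b₀ σ : ℝ) (n : Measure (ℝ × ℝ)) (u : ℂ × ℂ) : ℂ :=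
  (a₂ : ℂ) * u.1 - (b₀ : ℂ) * u.2 + (σ : ℂ) ^ 2 / 2 * u.2 ^ 2
    + ∫ z : ℝ × ℝ,
        (Complex.exp (u.1 * (z.1 : ℂ) + u.2 * (z.2 : ℂ)) - 1 - (z.2 : ℂ) * u.2) ∂n

/-- The branching mechanism `φ₀`. -/
def phi0 (a₁ α₁₁ α₁₂ : ℝ) (m : Measure (ℝ × ℝ)) (x : ℝ) : ℝ :=
  a₁ * x + (α₁₁ + α₁₂) * x ^ 2 + ∫ z : ℝ × ℝ, (Real.exp (-x * z.1) - 1 + x * z.1) ∂m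

/-- Condition (A): Grey's condition. -/
def CondA (a₁ α₁₁ α₁₂ : ℝ) (m : Measure (ℝ × ℝ)) : Prop :=
  ∃ θ > (0 : ℝ), (∀ z ≥ θ, 0 < phi0 a₁ α₁₁ α₁₂ m z) ∧
    ∫⁻ z in Set.Ici θ, ENNReal.ofReal (phi0 a₁ α₁₁ α₁₂ m z)⁻¹ < ⊤

/-- The measure `n_ε` on `ℝ`. -/
def nEps (n : Measure (ℝ × ℝ)) (ε : ℝ) : Measure ℝ :=
  if n {z : ℝ × ℝ | 0 ≤ z.1} < ⊤ then
    Measure.map Prod.snd (n.restrict {z : ℝ × ℝ | 0 ≤ z.1})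
  else
    Measure.map Prod.snd (n.restrict {z : ℝ × ℝ | 0 ≤ z.1 ∧ ε ≤ |z.2|})

/-- Condition (B), with the constants `ε, η` explicit. -/
def CondB (n : Measure (ℝ × ℝ)) (ε η : ℝ) : Prop :=
  0 < ε ∧ 0 < η ∧
  (∃ c : ℝ≥0∞, 0 < c ∧
      ∀ a : ℝ, |a| ≤ η → c ≤ (nEps n ε ⊓ translate a (nEps n ε)) Set.univ) ∧
  ∫⁻ z in {z : ℝ × ℝ | ε < |z.2|}, ENNReal.ofReal |z.2| ∂n < ⊤

/-- `limsup_{ρ → 0} [ sup_{|a| ≤ ρ} ‖σ - δ_a * σ‖_var / ρ ] < ∞`. -/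
def SmoothShift (σ : Measure ℝ) : Prop :=
  ∃ C > (0 : ℝ), ∃ δ > (0 : ℝ), ∀ ρ : ℝ, 0 < ρ → ρ ≤ δ →
    ∀ a : ℝ, |a| ≤ ρ → tvDist σ (translate a σ) ≤ C * ρ

/-- Condition (C), with the constant `ε` explicit. -/
def CondC (n : Measure (ℝ × ℝ)) (ε : ℝ) : Prop :=
  0 < ε ∧ 0 < nEps n ε Set.univ ∧ SmoothShift (nEps n ε) ∧
  ∫⁻ z in {z : ℝ × ℝ | ε < |z.2|}, ENNReal.ofReal |z.2| ∂n < ⊤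

/-- Condition (C'), with the constant `ε` explicit. -/
def CondC' (n : Measure (ℝ × ℝ)) (ε : ℝ) : Prop :=
  0 < ε ∧ 0 < nEps n ε Set.univ ∧ SmoothShift (nEps n ε) ∧
  ∫⁻ z in {z : ℝ × ℝ | 1 < |z.2|}, ENNReal.ofReal (z.2 ^ 2) ∂n < ⊤

/-- The measure `σ₀ = ϱ₀(z₂) dz₂` of Condition (D). -/
def sigma0 (ϱ₀ : ℝ → ℝ) : Measure ℝ :=
  volume.withDensity fun x => ENNReal.ofReal (ϱ₀ x)

/-- The measure `σ_k = ((k g) ∧ ϱ₀)(z₂) dz₂` of Condition (D). -/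
def sigmaK (ϱ₀ g : ℝ → ℝ) (k : ℕ) : Measure ℝ :=
  volume.withDensity fun x => ENNReal.ofReal (min ((k : ℝ) * g x) (ϱ₀ x))

/-- Condition (D), with `ϱ₀`, `g` and `K` explicit. -/
def CondD (n : Measure (ℝ × ℝ)) (ϱ₀ g : ℝ → ℝ) (K : ℕ) : Prop :=
  Measurable ϱ₀ ∧ (∀ x, 0 ≤ ϱ₀ x) ∧
  (∀ B : Set ℝ, MeasurableSet B → sigma0 ϱ₀ B ≤ n {z : ℝ × ℝ | 0 ≤ z.1 ∧ z.2 ∈ B}) ∧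
  0 < sigma0 ϱ₀ Set.univ ∧
  (∀ x, 0 < g x) ∧ Integrable g ∧ 1 ≤ K ∧
  ∀ k, K ≤ k → SmoothShift (sigmaK ϱ₀ g k) ∧
    ∫⁻ x, ENNReal.ofReal |x| ∂(sigmaK ϱ₀ g k) < ⊤

/-- The transition semigroup of a (1+1)-dimensional affine Markov process, together
with all the standing assumptions of the paper. -/
structure AffineSemigroup where
  a₁ : ℝ
  a₂ : ℝ
  b₀ : ℝ
  b₁ : ℝ
  b₂ : ℝ
  σ : ℝ
  α₁₁ : ℝ
  α₁₂ : ℝ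
  α₂₁ : ℝ
  α₂₂ : ℝ
  m : Measure (ℝ × ℝ)
  n : Measure (ℝ × ℝ)
  V₁ : ℝ → ℂ × ℂ → ℂ
  P : ℝ → ℝ × ℝ → Measure (ℝ × ℝ)
  a₂_nonneg : 0 ≤ a₂
  σ_nonneg : 0 ≤ σ
  α₁₁_nonneg : 0 ≤ α₁₁
  α₁₂_nonneg : 0 ≤ α₁₂
  α₂₁_nonneg : 0 ≤ α₂₁
  α₂₂_nonneg : 0 ≤ α₂₂
  m_supp : m {z : ℝ × ℝ | z.1 < 0 ∨ z = 0} = 0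
  n_supp : n {z : ℝ × ℝ | z.1 < 0 ∨ z = 0} = 0
  m_int : ∫⁻ z : ℝ × ℝ, ENNReal.ofReal (min z.1 (z.1 ^ 2) + z.2 ^ 2) ∂m < ⊤
  n_int : ∫⁻ z : ℝ × ℝ, ENNReal.ofReal (min 1 z.1 + min |z.2| (z.2 ^ 2)) ∂n < ⊤
  V₁_init : ∀ u : ℂ × ℂ, V₁ 0 u = u.1
  V₁_mem : ∀ u : ℂ × ℂ, u.1.re ≤ 0 → u.2.re = 0 → ∀ t, 0 ≤ t → (V₁ t u).re ≤ 0
  V₁_ode : ∀ u : ℂ × ℂ, u.1.re ≤ 0 → u.2.re = 0 → ∀ t, 0 ≤ t →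
    HasDerivAt (fun s => V₁ s u)
      (phi a₁ b₁ α₁₁ α₁₂ α₂₁ α₂₂ m
        (V₁ t u, Complex.exp (-(b₂ : ℂ) * (t : ℂ)) * u.2)) t
  P_prob : ∀ t, 0 ≤ t → ∀ x : ℝ × ℝ, 0 ≤ x.1 → IsProbabilityMeasure (P t x)
  P_supp : ∀ t, 0 ≤ t → ∀ x : ℝ × ℝ, 0 ≤ x.1 → P t x {ξ : ℝ × ℝ | ξ.1 < 0} = 0
  P_meas : ∀ t, 0 ≤ t → Measurable (P t)
  P_zero : ∀ x : ℝ × ℝ, P 0 x = Measure.dirac x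
  P_CK : ∀ t, 0 ≤ t → ∀ s, 0 ≤ s → ∀ x : ℝ × ℝ, P (t + s) x = (P t x).bind (P s)
  P_char : ∀ t, 0 ≤ t → ∀ x : ℝ × ℝ, 0 ≤ x.1 → ∀ u : ℂ × ℂ, u.1.re = 0 → u.2.re = 0 →
    ∫ ξ : ℝ × ℝ, Complex.exp (u.1 * (ξ.1 : ℂ) + u.2 * (ξ.2 : ℂ)) ∂(P t x)
      = Complex.exp ((x.1 : ℂ) * V₁ t u
          + (x.2 : ℂ) * (Complex.exp (-(b₂ : ℂ) * (t : ℂ)) * u.2)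
          + ∫ s in (0:ℝ)..t,
              psi a₂ b₀ σ n (V₁ s u, Complex.exp (-(b₂ : ℂ) * (s : ℂ)) * u.2))

/-- A stationary (invariant) distribution for the semigroup `P` on `G = ℝ₊ × ℝ`. -/
def IsStationary (P : ℝ → ℝ × ℝ → Measure (ℝ × ℝ)) (π : Measure (ℝ × ℝ)) : Prop :=
  IsProbabilityMeasure π ∧ π {x : ℝ × ℝ | x.1 < 0} = 0 ∧ ∀ t, 0 ≤ t → π.bind (P t) = π

/-- Defining properties of the minimal solution `v̄` of `(d/dt) v̄_t = -φ₀(v̄_t)`,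
`v̄_{0+} = ∞`. -/
def IsVbar (a₁ α₁₁ α₁₂ : ℝ) (m : Measure (ℝ × ℝ)) (v : ℝ → ℝ) : Prop :=
  (∀ t > (0 : ℝ), 0 < v t) ∧
  (∀ t > (0 : ℝ), HasDerivAt v (-(phi0 a₁ α₁₁ α₁₂ m (v t))) t) ∧
  Tendsto v (𝓝[>] (0 : ℝ)) atTop

section Pointwise

variable {v w : ℂ} {q p K : ℝ} {z : ℝ × ℝ}

/-- The weight `(z₁ ∧ z₁²) + z₂²`. -/
def weight (z : ℝ × ℝ) : ℝ := min z.1 (z.1 ^ 2) + z.2 ^ 2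

lemma norm_exp_sub_one_le_of_re_nonpos (hw : w.re ≤ 0) : ‖Complex.exp w - 1‖ ≤ ‖w‖ := by
  have h := (convex_halfSpace_re_le 0).norm_image_sub_le_of_norm_hasDerivWithin_le
    (f := Complex.exp) (f' := Complex.exp) (C := 1) (x := 0) (y := w)
    (fun x _ => (Complex.hasDerivAt_exp x).hasDerivWithinAt)
    (fun x hx => by simpa [Complex.norm_exp] using hx) (by simp) hw
  simpa using h

lemma norm_exp_le_one_of_re_nonpos (hw : w.re ≤ 0) : ‖Complex.exp w‖ ≤ 1 := by
  simpa [Complex.norm_exp] using hw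

lemma norm_exp_sub_one_le_two_of_re_nonpos (hw : w.re ≤ 0) : ‖Complex.exp w - 1‖ ≤ 2 :=
  (norm_sub_le _ _).trans (by simpa using by linarith [norm_exp_le_one_of_re_nonpos hw])

lemma norm_exp_sub_one_sub_le_of_re_nonpos (hw : w.re ≤ 0) :
    ‖Complex.exp w - 1 - w‖ ≤ ‖w‖ ^ 2 := by
  have h := ((convex_halfSpace_re_le 0).inter
      (convex_closedBall (0 : ℂ) ‖w‖)).norm_image_sub_le_of_norm_hasDerivWithin_le
    (f := fun x => Complex.exp x - x) (f' := fun x => Complex.exp x - 1) (C := ‖w‖) (x := 0) (y := w)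
    (fun x _ => ((Complex.hasDerivAt_exp x).sub (hasDerivAt_id x)).hasDerivWithinAt)
    (fun x hx => (norm_exp_sub_one_le_of_re_nonpos hx.1).trans (by simpa using hx.2))
    (by simp) ⟨hw, by simp⟩
  simp only [Complex.exp_zero, sub_zero] at h
  rw [show Complex.exp w - 1 - w = Complex.exp w - w - 1 by ring, sq]
  exact h

lemma re_conj_mul_exp_sub_one_sub_nonpos (hw : w.re ≤ 0) :
    (starRingEnd ℂ w * (Complex.exp w - 1 - w)).re ≤ 0 := by
  have h1 : (starRingEnd ℂ w * (Complex.exp w - 1)).re ≤ ‖w‖ * ‖w‖ :=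
    (Complex.re_le_norm _).trans (by
      rw [norm_mul, Complex.norm_conj]
      exact mul_le_mul_of_nonneg_left (norm_exp_sub_one_le_of_re_nonpos hw) (norm_nonneg _))
  have h2 : (starRingEnd ℂ w * w).re = ‖w‖ * ‖w‖ := by
    rw [mul_comm, Complex.mul_conj, Complex.normSq_eq_norm_sq, Complex.ofReal_re, sq]
  rw [mul_sub, Complex.sub_re, h2]
  linarith

lemma linear_re : (v * (z.1 : ℂ) + (q : ℂ) * Complex.I * (z.2 : ℂ)).re = v.re * z.1 := by simp

lemma linear_im :
    (v * (z.1 : ℂ) + (q : ℂ) * Complex.I * (z.2 : ℂ)).im = v.im * z.1 + q * z.2 := by simp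

lemma norm_exp_I_sub_one_le : ‖Complex.exp ((q : ℂ) * Complex.I * (z.2 : ℂ)) - 1‖ ≤ |q| * |z.2| := by
  simpa using norm_exp_sub_one_le_of_re_nonpos (w := (q : ℂ) * Complex.I * (z.2 : ℂ)) (by simp)

lemma norm_exp_I_sub_one_sub_le :
    ‖Complex.exp ((q : ℂ) * Complex.I * (z.2 : ℂ)) - 1 - (q : ℂ) * Complex.I * (z.2 : ℂ)‖
      ≤ q ^ 2 * z.2 ^ 2 := by
  simpa [mul_pow] using
    norm_exp_sub_one_sub_le_of_re_nonpos (w := (q : ℂ) * Complex.I * (z.2 : ℂ)) (by simp)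

lemma norm_mul_ofReal_of_nonneg (hz : 0 ≤ z.1) : ‖v * (z.1 : ℂ)‖ = ‖v‖ * z.1 := by
  rw [norm_mul, Complex.norm_real, Real.norm_of_nonneg hz]

lemma weight_nonneg (hz : 0 ≤ z.1) : 0 ≤ weight z := by
  unfold weight; positivity

lemma re_conj_mul_exp_le (hv : v.re ≤ 0) (hz : 0 ≤ z.1) (hq : 0 ≤ q) (hq1 : q ≤ 1) :
    (starRingEnd ℂ v * (Complex.exp (v * (z.1 : ℂ) + (q : ℂ) * Complex.I * (z.2 : ℂ)) - 1
      - (v * (z.1 : ℂ) + (q : ℂ) * Complex.I * (z.2 : ℂ)))).re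
      ≤ ‖v‖ * q * (2 + ‖v‖) * weight z := by
  set a : ℂ := v * (z.1 : ℂ) with ha
  set b : ℂ := (q : ℂ) * Complex.I * (z.2 : ℂ) with hb
  have hare : a.re ≤ 0 := by simp [ha]; exact mul_nonpos_of_nonpos_of_nonneg hv hz
  have hna : ‖a‖ = ‖v‖ * z.1 := norm_mul_ofReal_of_nonneg hz
  have hA : (starRingEnd ℂ v * (Complex.exp a - 1 - a)).re ≤ 0 := by
    rcases hz.eq_or_lt with h0 | h0
    · simp [ha, ← h0]
    · have h := re_conj_mul_exp_sub_one_sub_nonpos hare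
      have : starRingEnd ℂ a = (z.1 : ℂ) * starRingEnd ℂ v := by simp [ha, mul_comm]
      rw [this, mul_assoc, Complex.re_ofReal_mul] at h
      exact nonpos_of_mul_nonpos_right h h0
  have hB : ‖(Complex.exp a - 1) * (Complex.exp b - 1) + (Complex.exp b - 1 - b)‖
      ≤ q * (2 + ‖v‖) * weight z := by
    have h1 := norm_exp_sub_one_le_of_re_nonpos hare
    have h2 := norm_exp_sub_one_le_two_of_re_nonpos hare
    have h3 : ‖Complex.exp b - 1‖ ≤ q * |z.2| := by
      simpa [abs_of_nonneg hq] using norm_exp_I_sub_one_le (q := q) (z := z)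
    have h4 : ‖Complex.exp b - 1 - b‖ ≤ q ^ 2 * z.2 ^ 2 := norm_exp_I_sub_one_sub_le
    have h5 : q ^ 2 * z.2 ^ 2 ≤ q * z.2 ^ 2 := by
      have : q ^ 2 ≤ q := by nlinarith
      exact mul_le_mul_of_nonneg_right this (sq_nonneg _)
    have h6 := norm_nonneg v
    have h7 := abs_nonneg z.2
    have h8 := sq_abs z.2
    refine (norm_add_le _ _).trans ?_
    rw [norm_mul]
    rcases le_total z.1 1 with h | h
    · have hw : weight z = z.1 ^ 2 + z.2 ^ 2 := by
        rw [weight, min_eq_right (by nlinarith)]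
      have : ‖Complex.exp a - 1‖ * ‖Complex.exp b - 1‖ ≤ (‖v‖ * z.1) * (q * |z.2|) :=
        mul_le_mul (h1.trans hna.le) h3 (norm_nonneg _) (by positivity)
      have h9 : z.1 * |z.2| ≤ z.1 ^ 2 + z.2 ^ 2 := by nlinarith [sq_nonneg (z.1 - |z.2|)]
      have h10 : (q * ‖v‖) * (z.1 * |z.2|) ≤ (q * ‖v‖) * (z.1 ^ 2 + z.2 ^ 2) :=
        mul_le_mul_of_nonneg_left h9 (by positivity)
      have h11 : 0 ≤ q * z.1 ^ 2 := by positivity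
      have h12 : 0 ≤ q * z.2 ^ 2 := by positivity
      rw [hw]
      nlinarith
    · have hw : weight z = z.1 + z.2 ^ 2 := by
        rw [weight, min_eq_left (by nlinarith)]
      have : ‖Complex.exp a - 1‖ * ‖Complex.exp b - 1‖ ≤ 2 * (q * |z.2|) :=
        mul_le_mul h2 h3 (norm_nonneg _) (by positivity)
      have h9 : 2 * |z.2| ≤ z.1 + z.2 ^ 2 := by nlinarith [sq_nonneg (1 - |z.2|)]
      have h10 : q * (2 * |z.2|) ≤ q * (z.1 + z.2 ^ 2) := mul_le_mul_of_nonneg_left h9 hq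
      have h11 : 0 ≤ (q * ‖v‖) * (z.1 + z.2 ^ 2) := by positivity
      have h12 : 0 ≤ q * z.1 := by positivity
      rw [hw]
      nlinarith
  have heq : Complex.exp (a + b) - 1 - (a + b) = (Complex.exp a - 1 - a)
      + ((Complex.exp a - 1) * (Complex.exp b - 1) + (Complex.exp b - 1 - b)) := by
    rw [Complex.exp_add]; ring
  rw [heq, mul_add, Complex.add_re]
  have hC := (Complex.re_le_norm (starRingEnd ℂ v *
    ((Complex.exp a - 1) * (Complex.exp b - 1) + (Complex.exp b - 1 - b))))
  rw [norm_mul, Complex.norm_conj] at hC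
  have := mul_le_mul_of_nonneg_left hB (norm_nonneg v)
  nlinarith

/-- The truncated quadratic bound for `Re w + 1 - Re e^w`. -/
lemma one_add_re_sub_re_exp_le (hv : v.re ≤ 0) (hz : 0 ≤ z.1) (hq : 0 ≤ q) (hqp : q ≤ p)
    (hvK : ‖v‖ ≤ K * p) :
    1 + v.re * z.1 - (Complex.exp (v * (z.1 : ℂ) + (q : ℂ) * Complex.I * (z.2 : ℂ))).re
      ≤ 2 * min ((K * p * z.1) ^ 2) 1 + p ^ 2 * z.2 ^ 2 := by
  rw [Complex.exp_re, linear_re, linear_im]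
  set r := v.re * z.1
  have hr : r ≤ 0 := mul_nonpos_of_nonpos_of_nonneg hv hz
  set J := v.im * z.1 + q * z.2 with hJ
  have h1 := Real.add_one_le_exp r
  have h2 : 1 + r - Real.exp r * Real.cos J ≤ 1 - Real.cos J := by
    have : Real.exp r * (1 - Real.cos J) ≤ 1 * (1 - Real.cos J) :=
      mul_le_mul_of_nonneg_right (Real.exp_le_one_iff.2 hr) (by linarith [Real.cos_le_one J])
    linarith
  have h3 := Real.one_sub_sq_div_two_le_cos (x := J)
  have h4 := Real.neg_one_le_cos J
  have h5 : J ^ 2 / 2 ≤ (v.im * z.1) ^ 2 + (q * z.2) ^ 2 := by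
    rw [hJ]; nlinarith [sq_nonneg (v.im * z.1 - q * z.2)]
  have h6 : (v.im * z.1) ^ 2 ≤ (K * p * z.1) ^ 2 := by
    apply sq_le_sq'
    · have := (abs_le.1 ((Complex.abs_im_le_norm v).trans hvK)).1
      nlinarith
    · exact mul_le_mul_of_nonneg_right ((Complex.im_le_norm v).trans hvK) hz
  have h7 : (q * z.2) ^ 2 ≤ p ^ 2 * z.2 ^ 2 := by
    rw [mul_pow]
    exact mul_le_mul_of_nonneg_right (pow_le_pow_left₀ hq hqp 2) (sq_nonneg _)
  have h8 : 0 ≤ (K * p * z.1) ^ 2 := sq_nonneg _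
  have h9 : 0 ≤ p ^ 2 * z.2 ^ 2 := by positivity
  rcases le_total ((K * p * z.1) ^ 2) 1 with h | h
  · rw [min_eq_left h]; linarith
  · rw [min_eq_right h]; linarith

lemma norm_exp_sub_one_sub_snd_le (hv : v.re ≤ 0) (hz : 0 ≤ z.1) :
    ‖Complex.exp (v * (z.1 : ℂ) + (q : ℂ) * Complex.I * (z.2 : ℂ)) - 1
      - (z.2 : ℂ) * ((q : ℂ) * Complex.I)‖ ≤ ‖v‖ * z.1 + q ^ 2 * z.2 ^ 2 := by
  set a : ℂ := v * (z.1 : ℂ) with ha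
  set b : ℂ := (q : ℂ) * Complex.I * (z.2 : ℂ) with hb
  have hare : a.re ≤ 0 := by simp [ha]; exact mul_nonpos_of_nonpos_of_nonneg hv hz
  have heq : Complex.exp (a + b) - 1 - (z.2 : ℂ) * ((q : ℂ) * Complex.I)
      = Complex.exp b * (Complex.exp a - 1) + (Complex.exp b - 1 - b) := by
    rw [Complex.exp_add, hb]; ring
  rw [heq]
  refine (norm_add_le _ _).trans (add_le_add ?_ norm_exp_I_sub_one_sub_le)
  rw [norm_mul, ← norm_mul_ofReal_of_nonneg hz]
  calc _ ≤ 1 * ‖a‖ := mul_le_mul (norm_exp_le_one_of_re_nonpos (by simp [hb]))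
        (norm_exp_sub_one_le_of_re_nonpos hare) (norm_nonneg _) zero_le_one
    _ = _ := one_mul _

end Pointwise

section Integrals

lemma re_integral_le {α : Type*} [MeasurableSpace α] {μ : Measure α} {f : α → ℂ} {g : α → ℝ}
    (hg : Integrable g μ) (h0 : 0 ≤ᵐ[μ] g) (h : ∀ᵐ x ∂μ, (f x).re ≤ g x) :
    (∫ x, f x ∂μ).re ≤ ∫ x, g x ∂μ := by
  by_cases hf : Integrable f μ
  · rw [← RCLike.re_eq_complex_re, ← integral_re hf]
    exact integral_mono_ae hf.re hg h
  · rw [integral_undef hf]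
    exact integral_nonneg_of_ae h0

/-- The truncated second moment `∫ ((a z₁)² ∧ 1) μ(dz)`. -/
def trunc (μ : Measure (ℝ × ℝ)) (a : ℝ) : ℝ := ∫ z : ℝ × ℝ, min ((a * z.1) ^ 2) 1 ∂μ

lemma measurable_weight : Measurable weight := by unfold weight; fun_prop

lemma min_sq_le_weight {z : ℝ × ℝ} (hz : 0 ≤ z.1) (a : ℝ) :
    min ((a * z.1) ^ 2) 1 ≤ (1 + a ^ 2) * weight z := by
  have h2 := sq_nonneg z.2
  have ha := sq_nonneg a
  unfold weight
  rcases le_total z.1 1 with h | h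
  · rw [min_eq_right (a := z.1) (by nlinarith)]
    refine (min_le_left _ _).trans ?_
    nlinarith [sq_nonneg z.1, mul_nonneg ha h2]
  · rw [min_eq_left (a := z.1) (by nlinarith)]
    refine (min_le_right _ _).trans ?_
    nlinarith [mul_nonneg ha h2, mul_nonneg ha hz]

variable {μ : Measure (ℝ × ℝ)}

lemma integrable_min_sq (hμ : ∀ᵐ z ∂μ, 0 ≤ z.1) (hw : Integrable weight μ) (a : ℝ) :
    Integrable (fun z : ℝ × ℝ => min ((a * z.1) ^ 2) 1) μ := by
  refine (hw.const_mul (1 + a ^ 2)).mono' (by fun_prop) ?_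
  filter_upwards [hμ] with z hz
  rw [Real.norm_of_nonneg (by positivity)]
  exact min_sq_le_weight hz a

lemma integrable_snd_sq (hμ : ∀ᵐ z ∂μ, 0 ≤ z.1) (hw : Integrable weight μ) :
    Integrable (fun z : ℝ × ℝ => z.2 ^ 2) μ := by
  refine hw.mono' (by fun_prop) ?_
  filter_upwards [hμ] with z hz
  rw [Real.norm_of_nonneg (by positivity), weight]
  have : 0 ≤ min z.1 (z.1 ^ 2) := by positivity
  linarith

lemma integral_snd_sq_le (hμ : ∀ᵐ z ∂μ, 0 ≤ z.1) (hw : Integrable weight μ) :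
    ∫ z : ℝ × ℝ, z.2 ^ 2 ∂μ ≤ ∫ z, weight z ∂μ := by
  refine integral_mono_ae (integrable_snd_sq hμ hw) hw ?_
  filter_upwards [hμ] with z hz
  rw [weight]
  have : 0 ≤ min z.1 (z.1 ^ 2) := by positivity
  linarith

lemma integral_weight_nonneg (hμ : ∀ᵐ z ∂μ, 0 ≤ z.1) : 0 ≤ ∫ z, weight z ∂μ :=
  integral_nonneg_of_ae (hμ.mono fun _ h => weight_nonneg h)

lemma trunc_nonneg (a : ℝ) : 0 ≤ trunc μ a := integral_nonneg fun z => by positivity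

lemma trunc_mono (hμ : ∀ᵐ z ∂μ, 0 ≤ z.1) (hw : Integrable weight μ) {a b : ℝ} (ha : 0 ≤ a)
    (hab : a ≤ b) : trunc μ a ≤ trunc μ b := by
  refine integral_mono_ae (integrable_min_sq hμ hw a) (integrable_min_sq hμ hw b) ?_
  filter_upwards [hμ] with z hz
  gcongr

lemma trunc_add_snd_sq_le (hμ : ∀ᵐ z ∂μ, 0 ≤ z.1) (hw : Integrable weight μ) (a p : ℝ) :
    ∫ z : ℝ × ℝ, (2 * min ((a * z.1) ^ 2) 1 + p ^ 2 * z.2 ^ 2) ∂μ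
      ≤ 2 * trunc μ a + p ^ 2 * ∫ z, weight z ∂μ := by
  rw [integral_add ((integrable_min_sq hμ hw a).const_mul 2)
    ((integrable_snd_sq hμ hw).const_mul _), integral_const_mul, integral_const_mul]
  exact add_le_add le_rfl (mul_le_mul_of_nonneg_left (integral_snd_sq_le hμ hw) (sq_nonneg p))

end Integrals

section Mechanisms

variable {a₁ b₁ α₁₁ α₁₂ α₂₁ α₂₂ a₂ b₀ σ : ℝ} {m n : Measure (ℝ × ℝ)} {v : ℂ} {q p K : ℝ}

lemma re_conj_mul_phi_le (h₁₁ : 0 ≤ α₁₁) (h₁₂ : 0 ≤ α₁₂) (h₂₁ : 0 ≤ α₂₁) (h₂₂ : 0 ≤ α₂₂)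
    (hm : ∀ᵐ z ∂m, 0 ≤ z.1) (hw : Integrable weight m)
    (hv : v.re ≤ 0) (hq : 0 ≤ q) (hq1 : q ≤ 1) :
    (starRingEnd ℂ v * phi a₁ b₁ α₁₁ α₁₂ α₂₁ α₂₂ m (v, (q : ℂ) * Complex.I)).re
      ≤ -a₁ * ‖v‖ ^ 2 + q * ‖v‖ * (|b₁| + (α₂₁ + α₂₂) + 2 * ∫ z, weight z ∂m)
        + q * (∫ z, weight z ∂m) * ‖v‖ ^ 2 := by
  have hint : (starRingEnd ℂ v * ∫ z : ℝ × ℝ,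
      (Complex.exp (v * (z.1 : ℂ) + (q : ℂ) * Complex.I * (z.2 : ℂ)) - 1
        - (v * (z.1 : ℂ) + (q : ℂ) * Complex.I * (z.2 : ℂ))) ∂m).re
      ≤ ‖v‖ * q * (2 + ‖v‖) * ∫ z, weight z ∂m := by
    rw [← integral_const_mul, ← integral_const_mul]
    refine re_integral_le (hw.const_mul _) ?_ ?_
    · filter_upwards [hm] with z hz
      have := weight_nonneg hz
      exact mul_nonneg (by positivity) this
    · filter_upwards [hm] with z hz
      exact re_conj_mul_exp_le hv hz hq hq1
  have hnorm : ‖v‖ ^ 2 = v.re ^ 2 + v.im ^ 2 := by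
    rw [← Complex.normSq_eq_norm_sq, Complex.normSq_apply]; ring
  have hpoly (A s B : ℝ) : (starRingEnd ℂ v * (-(a₁ : ℂ) * v - (b₁ : ℂ) * ((q : ℂ) * Complex.I)
      + (A : ℂ) * v ^ 2 + 2 * (s : ℂ) * v * ((q : ℂ) * Complex.I)
      + (B : ℂ) * ((q : ℂ) * Complex.I) ^ 2)).re
      = -a₁ * ‖v‖ ^ 2 - b₁ * q * v.im + A * v.re * ‖v‖ ^ 2 - B * q ^ 2 * v.re := by
    rw [hnorm]
    simp [pow_two]
    ring
  simp only [phi]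
  rw [mul_add, Complex.add_re]
  have := hpoly (α₁₁ + α₁₂) (Real.sqrt (α₁₁ * α₂₁) + Real.sqrt (α₁₂ * α₂₂)) (α₂₁ + α₂₂)
  push_cast at this
  rw [this]
  have hre := abs_le.1 (Complex.abs_re_le_norm v)
  have e1 : -b₁ * q * v.im ≤ q * ‖v‖ * |b₁| := by
    calc -b₁ * q * v.im ≤ |(-b₁ * q * v.im)| := le_abs_self _
      _ = q * |v.im| * |b₁| := by rw [abs_mul, abs_mul, abs_neg, abs_of_nonneg hq]; ring
      _ ≤ _ := by gcongr; exact Complex.abs_im_le_norm v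
  have e2 : (α₁₁ + α₁₂) * v.re * ‖v‖ ^ 2 ≤ 0 :=
    mul_nonpos_of_nonpos_of_nonneg (mul_nonpos_of_nonneg_of_nonpos (by positivity) hv)
      (by positivity)
  have e3 : -((α₂₁ + α₂₂) * q ^ 2 * v.re) ≤ q * ‖v‖ * (α₂₁ + α₂₂) := by
    have h1 : q ^ 2 * (-v.re) ≤ q * ‖v‖ :=
      mul_le_mul (by nlinarith) (by linarith) (by linarith) hq
    have := mul_le_mul_of_nonneg_left h1 (add_nonneg h₂₁ h₂₂)
    linarith
  linarith

lemma neg_re_phi_le (h₁₁ : 0 ≤ α₁₁) (h₁₂ : 0 ≤ α₁₂) (h₂₁ : 0 ≤ α₂₁) (h₂₂ : 0 ≤ α₂₂)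
    (hm : ∀ᵐ z ∂m, 0 ≤ z.1) (hw : Integrable weight m)
    (hv : v.re ≤ 0) (hq : 0 ≤ q) (hqp : q ≤ p) (hvK : ‖v‖ ≤ K * p) :
    -(phi a₁ b₁ α₁₁ α₁₂ α₂₁ α₂₂ m (v, (q : ℂ) * Complex.I)).re
      ≤ a₁ * v.re + ((α₁₁ + α₁₂) * K ^ 2
          + 2 * (Real.sqrt (α₁₁ * α₂₁) + Real.sqrt (α₁₂ * α₂₂)) * K
          + (α₂₁ + α₂₂) + ∫ z, weight z ∂m) * p ^ 2 + 2 * trunc m (K * p) := by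
  have hint : (-∫ z : ℝ × ℝ,
      (Complex.exp (v * (z.1 : ℂ) + (q : ℂ) * Complex.I * (z.2 : ℂ)) - 1
        - (v * (z.1 : ℂ) + (q : ℂ) * Complex.I * (z.2 : ℂ))) ∂m).re
      ≤ 2 * trunc m (K * p) + p ^ 2 * ∫ z, weight z ∂m := by
    rw [← integral_neg]
    refine (re_integral_le (((integrable_min_sq hm hw (K * p)).const_mul 2).add
      ((integrable_snd_sq hm hw).const_mul (p ^ 2))) ?_ ?_).trans
      (trunc_add_snd_sq_le hm hw (K * p) p)
    · filter_upwards with z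
      simp only [Pi.zero_apply, Pi.add_apply]
      positivity
    · filter_upwards [hm] with z hz
      have := one_add_re_sub_re_exp_le hv hz hq hqp hvK
      simp only [Complex.neg_re, Complex.sub_re, linear_re, Complex.one_re, Pi.add_apply]
      linarith
  have hpoly (A s B : ℝ) : (-(a₁ : ℂ) * v - (b₁ : ℂ) * ((q : ℂ) * Complex.I)
      + (A : ℂ) * v ^ 2 + 2 * (s : ℂ) * v * ((q : ℂ) * Complex.I)
      + (B : ℂ) * ((q : ℂ) * Complex.I) ^ 2).re
      = -a₁ * v.re + A * (v.re ^ 2 - v.im ^ 2) - 2 * s * q * v.im - B * q ^ 2 := by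
    simp [pow_two]
    ring
  simp only [phi]
  rw [Complex.add_re]
  have := hpoly (α₁₁ + α₁₂) (Real.sqrt (α₁₁ * α₂₁) + Real.sqrt (α₁₂ * α₂₂)) (α₂₁ + α₂₂)
  push_cast at this
  rw [this]
  rw [Complex.neg_re] at hint
  have him := (abs_le.1 ((Complex.abs_im_le_norm v).trans hvK))
  have hsq : v.im ^ 2 ≤ K ^ 2 * p ^ 2 := by
    rw [← mul_pow]; exact sq_le_sq' him.1 him.2
  have hKp : 0 ≤ K * p := (norm_nonneg v).trans hvK
  have e1 := mul_le_mul_of_nonneg_left hsq (add_nonneg h₁₁ h₁₂)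
  have e2 := mul_nonneg (add_nonneg h₁₁ h₁₂) (sq_nonneg v.re)
  have e3 : q * v.im ≤ K * p ^ 2 := by
    calc q * v.im ≤ q * (K * p) := mul_le_mul_of_nonneg_left him.2 hq
      _ ≤ p * (K * p) := mul_le_mul_of_nonneg_right hqp hKp
      _ = _ := by ring
  have e4 := mul_le_mul_of_nonneg_left e3
    (add_nonneg (Real.sqrt_nonneg (α₁₁ * α₂₁)) (Real.sqrt_nonneg (α₁₂ * α₂₂)))
  have e5 := mul_le_mul_of_nonneg_left (pow_le_pow_left₀ hq hqp 2) (add_nonneg h₂₁ h₂₂)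
  linarith

lemma re_psi_polynomial :
    ((a₂ : ℂ) * v - (b₀ : ℂ) * ((q : ℂ) * Complex.I)
      + (σ : ℂ) ^ 2 / 2 * ((q : ℂ) * Complex.I) ^ 2).re = a₂ * v.re - σ ^ 2 / 2 * q ^ 2 := by
  have : (σ : ℂ) ^ 2 / 2 * ((q : ℂ) * Complex.I) ^ 2 = ((-(σ ^ 2 / 2 * q ^ 2) : ℝ) : ℂ) := by
    rw [mul_pow, Complex.I_sq]; push_cast; ring
  rw [this, Complex.add_re, Complex.ofReal_re]
  simp
  ring

lemma psi_re_nonpos (ha₂ : 0 ≤ a₂) (hn : ∀ᵐ z ∂n, 0 ≤ z.1) (hv : v.re ≤ 0) :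
    (psi a₂ b₀ σ n (v, (q : ℂ) * Complex.I)).re ≤ 0 := by
  have hint : (∫ z : ℝ × ℝ,
      (Complex.exp (v * (z.1 : ℂ) + (q : ℂ) * Complex.I * (z.2 : ℂ)) - 1
        - (z.2 : ℂ) * ((q : ℂ) * Complex.I)) ∂n).re ≤ ∫ z : ℝ × ℝ, (0 : ℝ) ∂n := by
    refine re_integral_le (integrable_zero _ _ _) (ae_of_all _ fun _ => le_rfl) ?_
    filter_upwards [hn] with z hz
    have h := (Complex.re_le_norm _).trans (norm_exp_le_one_of_re_nonpos
      (w := v * (z.1 : ℂ) + (q : ℂ) * Complex.I * (z.2 : ℂ))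
      (by rw [linear_re]; exact mul_nonpos_of_nonpos_of_nonneg hv hz))
    simp only [Complex.sub_re, Complex.one_re]
    have : ((z.2 : ℂ) * ((q : ℂ) * Complex.I)).re = 0 := by simp
    linarith
  simp only [psi]
  rw [Complex.add_re, re_psi_polynomial]
  rw [integral_zero] at hint
  have := mul_nonpos_of_nonneg_of_nonpos ha₂ hv
  have : 0 ≤ σ ^ 2 / 2 * q ^ 2 := by positivity
  linarith

lemma neg_re_psi_le (hn : ∀ᵐ z ∂n, 0 ≤ z.1) (hw : Integrable weight n)
    (hn1 : Integrable (fun z : ℝ × ℝ => z.1) n)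
    (hv : v.re ≤ 0) (hq : 0 ≤ q) (hqp : q ≤ p) (hvK : ‖v‖ ≤ K * p) :
    -(psi a₂ b₀ σ n (v, (q : ℂ) * Complex.I)).re
      ≤ (a₂ + ∫ z : ℝ × ℝ, z.1 ∂n) * (-v.re) + (σ ^ 2 / 2 + ∫ z, weight z ∂n) * p ^ 2
        + 2 * trunc n (K * p) := by
  have hint : (-∫ z : ℝ × ℝ,
      (Complex.exp (v * (z.1 : ℂ) + (q : ℂ) * Complex.I * (z.2 : ℂ)) - 1
        - (z.2 : ℂ) * ((q : ℂ) * Complex.I)) ∂n).re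
      ≤ (-v.re) * (∫ z : ℝ × ℝ, z.1 ∂n) + (2 * trunc n (K * p) + p ^ 2 * ∫ z, weight z ∂n) := by
    have hi2 := ((integrable_min_sq hn hw (K * p)).const_mul 2).add
      ((integrable_snd_sq hn hw).const_mul (p ^ 2))
    have hi1 := hn1.const_mul (-v.re)
    rw [← integral_neg]
    refine (re_integral_le (hi1.add hi2) ?_ ?_).trans ?_
    · filter_upwards [hn] with z hz
      simp only [Pi.zero_apply, Pi.add_apply]
      have : 0 ≤ -v.re * z.1 := mul_nonneg (by linarith) hz
      positivity
    · filter_upwards [hn] with z hz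
      have := one_add_re_sub_re_exp_le hv hz hq hqp hvK
      simp only [Complex.neg_re, Complex.sub_re, Complex.one_re, Pi.add_apply]
      have : ((z.2 : ℂ) * ((q : ℂ) * Complex.I)).re = 0 := by simp
      linarith
    · simp only [Pi.add_apply]
      have hadd := integral_add hi1 hi2
      simp only [Pi.add_apply] at hadd
      rw [hadd, integral_const_mul]
      exact add_le_add le_rfl (trunc_add_snd_sq_le hn hw (K * p) p)
  simp only [psi]
  rw [Complex.add_re, re_psi_polynomial]
  rw [Complex.neg_re] at hint
  have := mul_le_mul_of_nonneg_left (pow_le_pow_left₀ hq hqp 2)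
    (show 0 ≤ σ ^ 2 / 2 by positivity)
  linarith

lemma norm_psi_le (ha₂ : 0 ≤ a₂) (hn : ∀ᵐ z ∂n, 0 ≤ z.1) (hw : Integrable weight n)
    (hn1 : Integrable (fun z : ℝ × ℝ => z.1) n)
    (hv : v.re ≤ 0) (hq : 0 ≤ q) (hqp : q ≤ p) (hp1 : p ≤ 1) (hvK : ‖v‖ ≤ K * p) :
    ‖psi a₂ b₀ σ n (v, (q : ℂ) * Complex.I)‖
      ≤ (a₂ * K + |b₀| + σ ^ 2 / 2 + K * (∫ z : ℝ × ℝ, z.1 ∂n) + ∫ z, weight z ∂n) * p := by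
  have hp : 0 ≤ p := hq.trans hqp
  have hq2 : q ^ 2 ≤ p := by nlinarith
  have hint : ‖∫ z : ℝ × ℝ,
      (Complex.exp (v * (z.1 : ℂ) + (q : ℂ) * Complex.I * (z.2 : ℂ)) - 1
        - (z.2 : ℂ) * ((q : ℂ) * Complex.I)) ∂n‖
      ≤ K * p * (∫ z : ℝ × ℝ, z.1 ∂n) + p * ∫ z, weight z ∂n := by
    have hi1 := hn1.const_mul (K * p)
    have hi2 := (integrable_snd_sq hn hw).const_mul p
    refine (norm_integral_le_of_norm_le (hi1.add hi2) ?_).trans ?_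
    · filter_upwards [hn] with z hz
      refine (norm_exp_sub_one_sub_snd_le hv hz).trans ?_
      simp only [Pi.add_apply]
      gcongr
    · simp only [Pi.add_apply]
      rw [integral_add hi1 hi2, integral_const_mul, integral_const_mul]
      exact add_le_add le_rfl (mul_le_mul_of_nonneg_left (integral_snd_sq_le hn hw) hp)
  simp only [psi]
  have e1 : ‖(a₂ : ℂ) * v‖ ≤ a₂ * (K * p) := by
    rw [norm_mul, Complex.norm_real, Real.norm_of_nonneg ha₂]
    exact mul_le_mul_of_nonneg_left hvK ha₂
  have e2 : ‖(b₀ : ℂ) * ((q : ℂ) * Complex.I)‖ ≤ |b₀| * p := by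
    simp only [norm_mul, Complex.norm_real, Complex.norm_I, mul_one, Real.norm_eq_abs]
    rw [abs_of_nonneg hq]
    gcongr
  have e3 : ‖(σ : ℂ) ^ 2 / 2 * ((q : ℂ) * Complex.I) ^ 2‖ ≤ σ ^ 2 / 2 * p := by
    simp only [norm_mul, norm_div, norm_pow, Complex.norm_real, Complex.norm_I, mul_one,
      Real.norm_eq_abs, sq_abs, Complex.norm_ofNat]
    gcongr
  refine (norm_add_le _ _).trans ((add_le_add ((norm_add_le _ _).trans
    (add_le_add ((norm_sub_le _ _).trans (add_le_add e1 e2)) e3)) hint).trans ?_)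
  linarith

end Mechanisms

section Riccati

lemma exp_mul_mul_I (b t θ : ℝ) :
    Complex.exp (-(b : ℂ) * (t : ℂ)) * ((θ : ℂ) * Complex.I)
      = ((θ * Real.exp (-b * t) : ℝ) : ℂ) * Complex.I := by
  push_cast; ring

lemma hasDerivAt_exp_mul (k s : ℝ) :
    HasDerivAt (fun x => Real.exp (k * x)) (Real.exp (k * s) * k) s := by
  simpa using ((hasDerivAt_id s).const_mul k).exp

variable (S : AffineSemigroup)

/-- The solution `t ↦ V₁(t, (0, iθ))`. -/
def riccati (θ t : ℝ) : ℂ := S.V₁ t (0, (θ : ℂ) * Complex.I)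

lemma riccati_zero (θ : ℝ) : riccati S θ 0 = 0 := S.V₁_init _

lemma riccati_re_nonpos (θ : ℝ) {t : ℝ} (ht : 0 ≤ t) : (riccati S θ t).re ≤ 0 :=
  S.V₁_mem _ (by simp) (by simp) t ht

lemma hasDerivAt_riccati (θ : ℝ) {t : ℝ} (ht : 0 ≤ t) :
    HasDerivAt (riccati S θ) (phi S.a₁ S.b₁ S.α₁₁ S.α₁₂ S.α₂₁ S.α₂₂ S.m
      (riccati S θ t, ((θ * Real.exp (-S.b₂ * t) : ℝ) : ℂ) * Complex.I)) t := by
  have h := S.V₁_ode (0, (θ : ℂ) * Complex.I) (by simp) (by simp) t ht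
  simp only [exp_mul_mul_I] at h
  exact h

lemma exists_norm_riccati_le (ha₁ : 0 < S.a₁) (hb₂ : 0 < S.b₂)
    (hm : ∀ᵐ z ∂S.m, 0 ≤ z.1) (hw : Integrable weight S.m) :
    ∃ c K θ₀ : ℝ, 0 < c ∧ c ≤ S.b₂ ∧ 1 ≤ K ∧ 0 < θ₀ ∧ θ₀ ≤ 1 ∧
      ∀ θ, 0 ≤ θ → θ ≤ θ₀ → ∀ t, 0 ≤ t → ‖riccati S θ t‖ ≤ K * (θ * Real.exp (-c * t)) := by
  set M := ∫ z, weight z ∂S.m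
  have hM : 0 ≤ M := integral_weight_nonneg hm
  set C := |S.b₁| + (S.α₂₁ + S.α₂₂) + 2 * M
  set K₀ := 2 * C ^ 2 / S.a₁ with hK₀
  have hK₀0 : 0 ≤ K₀ := by positivity
  set c := min (S.a₁ / 4) (S.b₂ / 2) with hc
  have hc1 : c ≤ S.a₁ / 4 := min_le_left _ _
  have hc2 : c ≤ S.b₂ / 2 := min_le_right _ _
  refine ⟨c, Real.sqrt (K₀ / S.b₂) + 1, min 1 (S.a₁ / (2 * (M + 1))), by positivity, by linarith,
    by linarith [Real.sqrt_nonneg (K₀ / S.b₂)], by positivity, min_le_left _ _, ?_⟩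
  intro θ hθ hθ₀ t ht
  have hθ1 : θ ≤ 1 := hθ₀.trans (min_le_left _ _)
  have hθM : θ * M ≤ S.a₁ / 2 := by
    have h := hθ₀.trans (min_le_right _ _)
    rw [le_div_iff₀ (by positivity)] at h
    nlinarith
  have hD (s : ℝ) (hs : 0 ≤ s) := (hasDerivAt_riccati S θ hs).norm_sq
  have hD' (s : ℝ) (hs : 0 ≤ s) : 2 * inner ℝ (riccati S θ s)
      (phi S.a₁ S.b₁ S.α₁₁ S.α₁₂ S.α₂₁ S.α₂₂ S.m
        (riccati S θ s, ((θ * Real.exp (-S.b₂ * s) : ℝ) : ℂ) * Complex.I))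
      ≤ -(2 * c) * ‖riccati S θ s‖ ^ 2 + K₀ * (θ * Real.exp (-S.b₂ * s)) ^ 2 := by
    set q := θ * Real.exp (-S.b₂ * s)
    set r := ‖riccati S θ s‖
    have hq0 : 0 ≤ q := by positivity
    have hqθ : q ≤ θ := mul_le_of_le_one_right hθ (Real.exp_le_one_iff.2 (by nlinarith))
    have h := re_conj_mul_phi_le (a₁ := S.a₁) (b₁ := S.b₁) S.α₁₁_nonneg S.α₁₂_nonneg S.α₂₁_nonneg
      S.α₂₂_nonneg hm hw (riccati_re_nonpos S θ hs) hq0 (hqθ.trans hθ1)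
    rw [Complex.inner, mul_comm (phi _ _ _ _ _ _ _ _)]
    change _ ≤ -S.a₁ * r ^ 2 + q * r * C + q * M * r ^ 2 at h
    have h1 : q * M * r ^ 2 ≤ S.a₁ / 2 * r ^ 2 :=
      mul_le_mul_of_nonneg_right ((mul_le_mul_of_nonneg_right hqθ hM).trans hθM) (sq_nonneg _)
    have h2 : 2 * (q * r * C) ≤ S.a₁ / 2 * r ^ 2 + K₀ * q ^ 2 := by
      have : S.a₁ / 2 * r ^ 2 + K₀ * q ^ 2 - 2 * (q * r * C)
          = (S.a₁ * r - 2 * C * q) ^ 2 / (2 * S.a₁) := by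
        rw [hK₀]; field_simp; ring
      have h3 : 0 ≤ (S.a₁ * r - 2 * C * q) ^ 2 / (2 * S.a₁) := by positivity
      linarith
    have h4 : 2 * c * r ^ 2 ≤ S.a₁ / 2 * r ^ 2 :=
      mul_le_mul_of_nonneg_right (by linarith) (sq_nonneg _)
    linarith
  set F : ℝ → ℝ := fun s => ‖riccati S θ s‖ ^ 2 * Real.exp (2 * c * s)
    + K₀ * θ ^ 2 / S.b₂ * Real.exp (-S.b₂ * s) with hF
  have hFd (s : ℝ) (hs : 0 ≤ s) :=
    ((hD s hs).mul (hasDerivAt_exp_mul (2 * c) s)).add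
      ((hasDerivAt_exp_mul (-S.b₂) s).const_mul (K₀ * θ ^ 2 / S.b₂))
  have hanti : AntitoneOn F (Ici 0) := by
    refine antitoneOn_of_deriv_nonpos (convex_Ici 0)
      (fun s hs => (hFd s hs).continuousAt.continuousWithinAt)
      (fun s hs => (hFd s (interior_subset hs)).differentiableAt.differentiableWithinAt) ?_
    intro s hs
    have hs0 : 0 ≤ s := interior_subset hs
    refine (hFd s hs0).deriv.trans_le ?_
    have h1 := mul_le_mul_of_nonneg_right (hD' s hs0) (Real.exp_pos (2 * c * s)).le
    have h2 : K₀ * θ ^ 2 / S.b₂ * (Real.exp (-S.b₂ * s) * -S.b₂)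
        = -(K₀ * θ ^ 2 * Real.exp (-S.b₂ * s)) := by field_simp
    have h3 : Real.exp (-S.b₂ * s) ^ 2 * Real.exp (2 * c * s) ≤ Real.exp (-S.b₂ * s) := by
      rw [← Real.exp_nat_mul, ← Real.exp_add]
      apply Real.exp_le_exp.2
      push_cast
      nlinarith
    have h4 := mul_le_mul_of_nonneg_left h3 (show 0 ≤ K₀ * θ ^ 2 by positivity)
    rw [h2]
    nlinarith
  have h := hanti (mem_Ici.2 le_rfl) (mem_Ici.2 ht) ht
  simp only [hF, riccati_zero, norm_zero, mul_zero, Real.exp_zero] at h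
  have hpos : 0 ≤ K₀ * θ ^ 2 / S.b₂ * Real.exp (-S.b₂ * t) := by positivity
  have h1 : ‖riccati S θ t‖ ^ 2 * Real.exp (2 * c * t) ≤ K₀ / S.b₂ * θ ^ 2 := by
    have : K₀ * θ ^ 2 / S.b₂ = K₀ / S.b₂ * θ ^ 2 := by ring
    linarith
  have h2 : ‖riccati S θ t‖ ^ 2 ≤ (Real.sqrt (K₀ / S.b₂) * (θ * Real.exp (-c * t))) ^ 2 := by
    rw [mul_pow, mul_pow, Real.sq_sqrt (by positivity), ← mul_assoc, ← Real.exp_nat_mul,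
      ← mul_inv_le_iff₀ (Real.exp_pos _), ← Real.exp_neg,
      show -((2 : ℕ) * (-c * t)) = 2 * c * t by push_cast; ring]
    exact h1
  have h3 := abs_le_of_sq_le_sq h2 (by positivity)
  rw [abs_of_nonneg (norm_nonneg _)] at h3
  have : 0 ≤ θ * Real.exp (-c * t) := by positivity
  linarith

/-- The integrand dominating `-Re ψ` along the solution, up to constants. -/
def dominant (c K θ s : ℝ) : ℝ :=
  (θ * Real.exp (-c * s)) ^ 2 + trunc S.m (K * (θ * Real.exp (-c * s)))
    + trunc S.n (K * (θ * Real.exp (-c * s)))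

lemma dominant_nonneg (c K θ s : ℝ) : 0 ≤ dominant S c K θ s := by
  have := trunc_nonneg (μ := S.m) (K * (θ * Real.exp (-c * s)))
  have := trunc_nonneg (μ := S.n) (K * (θ * Real.exp (-c * s)))
  unfold dominant; positivity

lemma antitone_dominant {c K θ : ℝ} (hm : ∀ᵐ z ∂S.m, 0 ≤ z.1) (hmw : Integrable weight S.m)
    (hn : ∀ᵐ z ∂S.n, 0 ≤ z.1) (hnw : Integrable weight S.n)
    (hc : 0 < c) (hK : 1 ≤ K) (hθ : 0 ≤ θ) : Antitone (dominant S c K θ) := by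
  intro s t hst
  have h : θ * Real.exp (-c * t) ≤ θ * Real.exp (-c * s) :=
    mul_le_mul_of_nonneg_left (Real.exp_le_exp.2 (by nlinarith)) hθ
  have h0 : 0 ≤ θ * Real.exp (-c * t) := by positivity
  have hK' := mul_le_mul_of_nonneg_left h (zero_le_one.trans hK)
  unfold dominant
  exact add_le_add (add_le_add (pow_le_pow_left₀ h0 h 2)
    (trunc_mono hm hmw (by positivity) hK')) (trunc_mono hn hnw (by positivity) hK')

/-- The exponent `∫₀ᵀ ψ(V(s, (0, iθ))) ds`. -/
def cumulant (θ T : ℝ) : ℂ :=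
  ∫ s in (0:ℝ)..T, psi S.a₂ S.b₀ S.σ S.n
    (riccati S θ s, ((θ * Real.exp (-S.b₂ * s) : ℝ) : ℂ) * Complex.I)

lemma cumulant_re_nonpos (hn : ∀ᵐ z ∂S.n, 0 ≤ z.1) (θ : ℝ) {T : ℝ} (hT : 0 ≤ T) :
    (cumulant S θ T).re ≤ 0 := by
  unfold cumulant
  rw [intervalIntegral.integral_of_le hT]
  refine (re_integral_le (integrable_zero _ ℝ _) (ae_of_all _ fun _ => le_rfl) ?_).trans
    (by simp)
  filter_upwards [ae_restrict_mem measurableSet_Ioc] with s hs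
  exact psi_re_nonpos S.a₂_nonneg hn (riccati_re_nonpos S θ hs.1.le)

lemma exists_norm_cumulant_le {c K θ₀ : ℝ} (hn : ∀ᵐ z ∂S.n, 0 ≤ z.1)
    (hnw : Integrable weight S.n) (hn1 : Integrable (fun z : ℝ × ℝ => z.1) S.n)
    (hc : 0 < c) (hcb : c ≤ S.b₂) (hK : 1 ≤ K) (hθ₀ : θ₀ ≤ 1)
    (hV : ∀ θ, 0 ≤ θ → θ ≤ θ₀ → ∀ t, 0 ≤ t → ‖riccati S θ t‖ ≤ K * (θ * Real.exp (-c * t))) :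
    ∃ C : ℝ, 0 ≤ C ∧ ∀ θ, 0 ≤ θ → θ ≤ θ₀ → ∀ T, 0 ≤ T → ‖cumulant S θ T‖ ≤ C * θ := by
  set L := S.a₂ * K + |S.b₀| + S.σ ^ 2 / 2 + K * (∫ z : ℝ × ℝ, z.1 ∂S.n) + ∫ z, weight z ∂S.n
    with hL
  have hL0 : 0 ≤ L := by
    have h1 := integral_weight_nonneg hn
    have h2 : 0 ≤ ∫ z : ℝ × ℝ, z.1 ∂S.n := integral_nonneg_of_ae hn
    have := S.a₂_nonneg
    positivity
  refine ⟨L / c, by positivity, fun θ hθ hθ1 T hT => ?_⟩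
  have hbound : ‖cumulant S θ T‖ ≤ ∫ s in (0:ℝ)..T, L * (θ * Real.exp (-c * s)) := by
    refine intervalIntegral.norm_integral_le_of_norm_le hT (ae_of_all _ fun s hs => ?_)
      (Continuous.intervalIntegrable (by fun_prop) _ _)
    have hs0 := hs.1.le
    refine norm_psi_le S.a₂_nonneg hn hnw hn1 (riccati_re_nonpos S θ hs0) (by positivity) ?_ ?_
      (hV θ hθ hθ1 s hs0)
    · exact mul_le_mul_of_nonneg_left (Real.exp_le_exp.2 (by nlinarith)) hθ
    · exact (mul_le_of_le_one_right hθ (Real.exp_le_one_iff.2 (by nlinarith))).trans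
        (hθ1.trans hθ₀)
  refine hbound.trans ?_
  have hint : ∫ s in (0:ℝ)..T, L * (θ * Real.exp (-c * s))
      = -(L * θ / c) * Real.exp (-c * T) - -(L * θ / c) * Real.exp (-c * 0) := by
    refine intervalIntegral.integral_eq_sub_of_hasDerivAt
      (f := fun s => -(L * θ / c) * Real.exp (-c * s)) (fun s _ => ?_)
      (Continuous.intervalIntegrable (by fun_prop) _ _)
    refine ((hasDerivAt_exp_mul (-c) s).const_mul (-(L * θ / c))).congr_deriv ?_
    field_simp
  rw [hint]
  have : 0 ≤ L * θ / c * Real.exp (-c * T) := by positivity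
  simp only [mul_zero, Real.exp_zero, mul_one]
  have h2 : L / c * θ = L * θ / c := by ring
  linarith

lemma exists_neg_re_cumulant_le {c K θ₀ : ℝ} (ha₁ : 0 < S.a₁)
    (hm : ∀ᵐ z ∂S.m, 0 ≤ z.1) (hmw : Integrable weight S.m) (hn : ∀ᵐ z ∂S.n, 0 ≤ z.1)
    (hnw : Integrable weight S.n) (hn1 : Integrable (fun z : ℝ × ℝ => z.1) S.n)
    (hc : 0 < c) (hcb : c ≤ S.b₂) (hK : 1 ≤ K)
    (hV : ∀ θ, 0 ≤ θ → θ ≤ θ₀ → ∀ t, 0 ≤ t → ‖riccati S θ t‖ ≤ K * (θ * Real.exp (-c * t))) :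
    ∃ C : ℝ, 0 ≤ C ∧ ∀ θ, 0 ≤ θ → θ ≤ θ₀ → ∀ T, 0 ≤ T →
      -(cumulant S θ T).re ≤ C * ∫ s in (0:ℝ)..T, dominant S c K θ s := by
  set C₁ := (S.α₁₁ + S.α₁₂) * K ^ 2
    + 2 * (Real.sqrt (S.α₁₁ * S.α₂₁) + Real.sqrt (S.α₁₂ * S.α₂₂)) * K
    + (S.α₂₁ + S.α₂₂) + ∫ z, weight z ∂S.m with hC₁
  set C₂ := S.σ ^ 2 / 2 + ∫ z, weight z ∂S.n with hC₂
  set A := S.a₂ + ∫ z : ℝ × ℝ, z.1 ∂S.n with hA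
  have hA0 : 0 ≤ A := add_nonneg S.a₂_nonneg (integral_nonneg_of_ae hn)
  have hC₁0 : 0 ≤ C₁ := by
    have := integral_weight_nonneg hm
    have := S.α₁₁_nonneg
    have := S.α₁₂_nonneg
    have := S.α₂₁_nonneg
    have := S.α₂₂_nonneg
    positivity
  have hC₂0 : 0 ≤ C₂ := by
    have := integral_weight_nonneg hn
    positivity
  refine ⟨A / S.a₁ * (C₁ + 2) + (C₂ + 2), by positivity, fun θ hθ hθ1 T hT => ?_⟩
  have hQ : IntervalIntegrable (dominant S c K θ) volume 0 T :=
    (antitone_dominant S hm hmw hn hnw hc hK hθ).intervalIntegrable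
  have hQ0 : 0 ≤ ∫ s in (0:ℝ)..T, dominant S c K θ s :=
    intervalIntegral.integral_nonneg hT fun s _ => dominant_nonneg S c K θ s
  have hq0 (s : ℝ) : 0 ≤ θ * Real.exp (-S.b₂ * s) := by positivity
  have hqp (s : ℝ) (hs : 0 ≤ s) : θ * Real.exp (-S.b₂ * s) ≤ θ * Real.exp (-c * s) :=
    mul_le_mul_of_nonneg_left (Real.exp_le_exp.2 (by nlinarith)) hθ
  have hle (B : ℝ) (hB : 0 ≤ B) (s : ℝ) :
      (B * (θ * Real.exp (-c * s)) ^ 2 + 2 * trunc S.m (K * (θ * Real.exp (-c * s)))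
        ≤ (B + 2) * dominant S c K θ s) ∧
      (B * (θ * Real.exp (-c * s)) ^ 2 + 2 * trunc S.n (K * (θ * Real.exp (-c * s)))
        ≤ (B + 2) * dominant S c K θ s) := by
    have h1 := trunc_nonneg (μ := S.m) (K * (θ * Real.exp (-c * s)))
    have h2 := trunc_nonneg (μ := S.n) (K * (θ * Real.exp (-c * s)))
    have h3 := sq_nonneg (θ * Real.exp (-c * s))
    have h4 := mul_nonneg hB h1
    have h5 := mul_nonneg hB h2
    unfold dominant
    constructor <;> linarith
  have hcont : ContinuousOn (fun s => -(riccati S θ s).re) (Icc 0 T) := fun s hs =>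
    (Complex.continuous_re.continuousAt.comp
      (hasDerivAt_riccati S θ hs.1).continuousAt).neg.continuousWithinAt
  have hRint : IntervalIntegrable (fun s => -(riccati S θ s).re) volume 0 T := by
    rw [← uIcc_of_le hT] at hcont
    exact hcont.intervalIntegrable
  have hR : S.a₁ * ∫ s in (0:ℝ)..T, -(riccati S θ s).re
      ≤ (C₁ + 2) * ∫ s in (0:ℝ)..T, dominant S c K θ s := by
    have hI := (hQ.const_mul (C₁ + 2)).sub (hRint.const_mul S.a₁)
    have h := intervalIntegral.sub_le_integral_of_hasDeriv_right_of_le hT hcont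
      (fun s hs => ((Complex.reCLM.hasFDerivAt.comp_hasDerivAt s
        (hasDerivAt_riccati S θ hs.1.le)).neg).hasDerivWithinAt)
      ((intervalIntegrable_iff_integrableOn_Icc_of_le hT).1 hI)
      (fun s hs => by
        have h := neg_re_phi_le (a₁ := S.a₁) (b₁ := S.b₁) S.α₁₁_nonneg S.α₁₂_nonneg S.α₂₁_nonneg
          S.α₂₂_nonneg hm hmw (riccati_re_nonpos S θ hs.1.le) (hq0 s) (hqp s hs.1.le)
          (hV θ hθ hθ1 s hs.1.le)
        rw [← hC₁] at h
        have h2 := (hle C₁ hC₁0 s).1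
        simp only [Complex.reCLM_apply]
        linarith)
    rw [intervalIntegral.integral_sub (hQ.const_mul _) (hRint.const_mul _),
      intervalIntegral.integral_const_mul, intervalIntegral.integral_const_mul, riccati_zero] at h
    have := riccati_re_nonpos S θ hT
    simp only [Complex.zero_re] at h
    linarith
  have hmain : -(cumulant S θ T).re
      ≤ A * (∫ s in (0:ℝ)..T, -(riccati S θ s).re)
        + (C₂ + 2) * ∫ s in (0:ℝ)..T, dominant S c K θ s := by
    have hI := (hRint.const_mul A).add (hQ.const_mul (C₂ + 2))
    rw [← intervalIntegral.integral_const_mul, ← intervalIntegral.integral_const_mul,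
      ← intervalIntegral.integral_add (hRint.const_mul A) (hQ.const_mul (C₂ + 2)),
      ← Complex.neg_re, cumulant, ← intervalIntegral.integral_neg,
      intervalIntegral.integral_of_le hT, intervalIntegral.integral_of_le hT]
    refine re_integral_le ((intervalIntegrable_iff_integrableOn_Ioc_of_le hT).1 hI) ?_ ?_
    · filter_upwards [ae_restrict_mem measurableSet_Ioc] with s hs
      have h1 := riccati_re_nonpos S θ hs.1.le
      have h2 := dominant_nonneg S c K θ s
      exact add_nonneg (mul_nonneg hA0 (by linarith)) (by positivity)
    · filter_upwards [ae_restrict_mem measurableSet_Ioc] with s hs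
      have h := neg_re_psi_le (a₂ := S.a₂) (b₀ := S.b₀) (σ := S.σ) hn hnw hn1
        (riccati_re_nonpos S θ hs.1.le) (hq0 s) (hqp s hs.1.le) (hV θ hθ hθ1 s hs.1.le)
      rw [← hC₂, ← hA] at h
      have h2 := (hle C₂ hC₂0 s).2
      rw [Complex.neg_re]
      linarith
  have hfin : A * (∫ s in (0:ℝ)..T, -(riccati S θ s).re)
      ≤ A / S.a₁ * ((C₁ + 2) * ∫ s in (0:ℝ)..T, dominant S c K θ s) := by
    rw [div_mul_eq_mul_div, le_div_iff₀ ha₁, mul_assoc, mul_comm _ S.a₁]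
    exact mul_le_mul_of_nonneg_left hR hA0
  linarith

end Riccati

section Tonelli

variable {μ : Measure (ℝ × ℝ)}

lemma ae_nonneg_of_null (h : μ {z : ℝ × ℝ | z.1 < 0 ∨ z = 0} = 0) : ∀ᵐ z ∂μ, 0 ≤ z.1 :=
  measure_mono_null (fun z (hz : ¬ 0 ≤ z.1) => Or.inl (not_le.1 hz)) h

lemma sigmaFinite_of_integrable_weight (h : μ {z : ℝ × ℝ | z.1 < 0 ∨ z = 0} = 0)
    (hw : Integrable weight μ) : SigmaFinite μ := by
  refine Measure.sigmaFinite_of_countable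
    (S := insert {z : ℝ × ℝ | z.1 < 0 ∨ z = 0}
      (range fun n : ℕ => {z : ℝ × ℝ | 1 / ((n : ℝ) + 1) ≤ weight z}))
    ((countable_range _).insert _) ?_ ?_
  · rintro s (rfl | ⟨n, rfl⟩)
    · rw [h]; exact ENNReal.zero_lt_top
    · exact hw.measure_ge_lt_top (by positivity)
  · refine eq_univ_of_forall fun z => ?_
    by_cases hz : z.1 < 0 ∨ z = 0
    · exact ⟨_, mem_insert _ _, hz⟩
    · push Not at hz
      have hpos : 0 < weight z := by
        unfold weight
        rcases hz.1.eq_or_lt with h0 | h0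
        · have : z.2 ≠ 0 := fun h2 => hz.2 (Prod.ext h0.symm h2)
          have : 0 ≤ min z.1 (z.1 ^ 2) := by rw [← h0]; simp
          positivity
        · have : 0 < min z.1 (z.1 ^ 2) := by positivity
          positivity
      obtain ⟨n, hn⟩ := exists_nat_one_div_lt hpos
      exact ⟨_, mem_insert_of_mem _ ⟨n, rfl⟩, hn.le⟩

lemma arctan_le_self {x : ℝ} (hx : 0 ≤ x) : Real.arctan x ≤ x := by
  simpa [Real.tan_arctan] using
    Real.le_tan (Real.arctan_nonneg.2 hx) (Real.arctan_lt_pi_div_two x)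

lemma lintegral_min_sq_div_sq_le {a θ₀ : ℝ} (ha : 0 ≤ a) (hθ₀ : 0 ≤ θ₀) (hθ₁ : θ₀ ≤ 1) :
    ∫⁻ θ in Ioc 0 θ₀, ENNReal.ofReal (min ((a * θ) ^ 2) 1 / θ ^ 2)
      ≤ ENNReal.ofReal (4 * min a (a ^ 2)) := by
  have hcont : Continuous fun θ : ℝ => 2 * a * (1 / (1 + (a * θ) ^ 2) * a) :=
    continuous_const.mul ((continuous_const.div (by fun_prop) fun θ => by positivity).mul
      continuous_const)
  have hint : ∫ θ in (0:ℝ)..θ₀, 2 * a * (1 / (1 + (a * θ) ^ 2) * a)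
      = 2 * a * Real.arctan (a * θ₀) := by
    rw [intervalIntegral.integral_eq_sub_of_hasDerivAt
      (f := fun θ => 2 * a * Real.arctan (a * θ)) (fun θ _ => ?_)
      (hcont.intervalIntegrable _ _)]
    · simp
    · simpa using (((hasDerivAt_id θ).const_mul a).arctan).const_mul (2 * a)
  calc ∫⁻ θ in Ioc 0 θ₀, ENNReal.ofReal (min ((a * θ) ^ 2) 1 / θ ^ 2)
      ≤ ∫⁻ θ in Ioc 0 θ₀, ENNReal.ofReal (2 * a * (1 / (1 + (a * θ) ^ 2) * a)) := by
        refine setLIntegral_mono' measurableSet_Ioc fun θ hθ => ENNReal.ofReal_le_ofReal ?_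
        have hθ0 := hθ.1
        have h1 : 2 * a * (1 / (1 + (a * θ) ^ 2) * a)
            = 2 * (a * θ) ^ 2 / (1 + (a * θ) ^ 2) / θ ^ 2 := by field_simp
        rw [h1]
        refine div_le_div_of_nonneg_right ?_ (sq_nonneg θ)
        rw [le_div_iff₀ (by positivity)]
        have h2 := sq_nonneg (a * θ)
        rcases le_total ((a * θ) ^ 2) 1 with h | h
        · rw [min_eq_left h]; nlinarith
        · rw [min_eq_right h]; linarith
    _ = ENNReal.ofReal (2 * a * Real.arctan (a * θ₀)) := by
        rw [← hint, intervalIntegral.integral_of_le hθ₀, ofReal_integral_eq_lintegral_ofReal]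
        · exact (intervalIntegrable_iff_integrableOn_Ioc_of_le hθ₀).1 (hcont.intervalIntegrable _ _)
        · exact ae_of_all _ fun θ => by positivity
    _ ≤ _ := by
        refine ENNReal.ofReal_le_ofReal ?_
        have h1 : Real.arctan (a * θ₀) ≤ 2 := by
          linarith [Real.arctan_lt_pi_div_two (a * θ₀), Real.pi_lt_four]
        have h2 : Real.arctan (a * θ₀) ≤ a :=
          (arctan_le_self (by positivity)).trans (mul_le_of_le_one_right ha hθ₁)
        rcases min_choice a (a ^ 2) with h | h <;> rw [h] <;> nlinarith

lemma min_mul_sq_le_weight {z : ℝ × ℝ} {K ε : ℝ} (hz : 0 ≤ z.1) (hK : 1 ≤ K) (hε : 0 ≤ ε)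
    (hε1 : ε ≤ 1) : min (K * ε * z.1) ((K * ε * z.1) ^ 2) ≤ K ^ 2 * ε * weight z := by
  have hz2 := sq_nonneg z.2
  have hc : 0 ≤ K ^ 2 * ε := by positivity
  unfold weight
  rw [mul_add, mul_min_of_nonneg _ _ hc]
  refine le_add_of_le_of_nonneg (min_le_min ?_ ?_) (by positivity)
  · refine mul_le_mul_of_nonneg_right (mul_le_mul_of_nonneg_right (by nlinarith) hε) hz
  · rw [mul_pow, mul_pow]
    refine mul_le_mul_of_nonneg_right (mul_le_mul_of_nonneg_left (by nlinarith) (by positivity))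
      (sq_nonneg _)

lemma lintegral_exp_neg_lt_top {c : ℝ} (hc : 0 < c) :
    ∫⁻ s in Ioi (0:ℝ), ENNReal.ofReal (Real.exp (-c * s)) < ⊤ :=
  (exp_neg_integrableOn_Ioi 0 hc).lintegral_lt_top

lemma lintegral_min_sq_lt_top [SigmaFinite μ] (hμ : ∀ᵐ z ∂μ, 0 ≤ z.1) (hw : Integrable weight μ)
    {c K θ₀ : ℝ} (hc : 0 < c) (hK : 1 ≤ K) (hθ₀ : 0 ≤ θ₀) (hθ₁ : θ₀ ≤ 1) :
    ∫⁻ θ in Ioc 0 θ₀, ∫⁻ s in Ioi (0:ℝ), ∫⁻ z : ℝ × ℝ,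
      ENNReal.ofReal (min ((K * (θ * Real.exp (-c * s)) * z.1) ^ 2) 1 / θ ^ 2) ∂μ < ⊤ := by
  have hmeas : Measurable fun x : (ℝ × ℝ) × (ℝ × ℝ) => ENNReal.ofReal
      (min ((K * (x.1.1 * Real.exp (-c * x.1.2)) * x.2.1) ^ 2) 1 / x.1.1 ^ 2) := by
    fun_prop
  rw [lintegral_lintegral_swap hmeas.lintegral_prod_right'.aemeasurable]
  have hswap (s : ℝ) : ∫⁻ θ in Ioc 0 θ₀, ∫⁻ z : ℝ × ℝ,
      ENNReal.ofReal (min ((K * (θ * Real.exp (-c * s)) * z.1) ^ 2) 1 / θ ^ 2) ∂μ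
      = ∫⁻ z : ℝ × ℝ, (∫⁻ θ in Ioc 0 θ₀,
      ENNReal.ofReal (min ((K * (θ * Real.exp (-c * s)) * z.1) ^ 2) 1 / θ ^ 2)) ∂μ :=
    lintegral_lintegral_swap (by fun_prop)
  have hbound (s : ℝ) (hs : s ∈ Ioi (0:ℝ)) : ∫⁻ θ in Ioc 0 θ₀, ∫⁻ z : ℝ × ℝ,
      ENNReal.ofReal (min ((K * (θ * Real.exp (-c * s)) * z.1) ^ 2) 1 / θ ^ 2) ∂μ
      ≤ ENNReal.ofReal (Real.exp (-c * s)) *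
        ∫⁻ z, ENNReal.ofReal (4 * K ^ 2 * weight z) ∂μ := by
    rw [hswap, ← lintegral_const_mul _ (by have := measurable_weight; fun_prop)]
    refine lintegral_mono_ae ?_
    filter_upwards [hμ] with z hz
    have h := lintegral_min_sq_div_sq_le (a := K * Real.exp (-c * s) * z.1) (by positivity) hθ₀ hθ₁
    rw [← ENNReal.ofReal_mul (Real.exp_pos _).le]
    have h2 := min_mul_sq_le_weight hz hK (Real.exp_pos (-c * s)).le
      (Real.exp_le_one_iff.2 (by nlinarith [mem_Ioi.1 hs]))
    refine le_trans (le_of_eq ?_) (h.trans (ENNReal.ofReal_le_ofReal (by linarith)))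
    congr! 6 with θ
    ring
  refine (setLIntegral_mono' measurableSet_Ioi hbound).trans_lt ?_
  rw [lintegral_mul_const _ (by fun_prop)]
  exact ENNReal.mul_lt_top (lintegral_exp_neg_lt_top hc) (hw.const_mul _).lintegral_lt_top

lemma le_lintegral_one_sub_cos {θ₀ : ℝ} (hθ₀ : 0 < θ₀) (y : ℝ) :
    ENNReal.ofReal |y| ≤ ENNReal.ofReal (1 / θ₀) + ENNReal.ofReal (Real.pi ^ 2 / 2) *
      ∫⁻ θ in Ioc 0 θ₀, ENNReal.ofReal ((1 - Real.cos (θ * y)) / θ ^ 2) := by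
  rcases le_or_gt |y| (1 / θ₀) with h | h
  · exact (ENNReal.ofReal_le_ofReal h).trans le_self_add
  · have hy : 0 < |y| := (by positivity : 0 < 1 / θ₀).trans h
    have hle : 1 / |y| ≤ θ₀ := by
      rw [div_lt_iff₀ hθ₀] at h
      rw [div_le_iff₀ hy]
      linarith
    refine le_trans ?_ le_add_self
    have hlow : ENNReal.ofReal (2 / Real.pi ^ 2 * y ^ 2) * ENNReal.ofReal (1 / |y|)
        ≤ ∫⁻ θ in Ioc 0 θ₀, ENNReal.ofReal ((1 - Real.cos (θ * y)) / θ ^ 2) := by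
      calc _ = ∫⁻ θ in Ioc 0 (1 / |y|), ENNReal.ofReal (2 / Real.pi ^ 2 * y ^ 2) := by
            rw [setLIntegral_const, Real.volume_Ioc, sub_zero]
        _ ≤ ∫⁻ θ in Ioc 0 (1 / |y|), ENNReal.ofReal ((1 - Real.cos (θ * y)) / θ ^ 2) := by
            refine setLIntegral_mono' measurableSet_Ioc fun θ hθ => ENNReal.ofReal_le_ofReal ?_
            have h0 : 0 < θ := hθ.1
            rw [le_div_iff₀ (by positivity)]
            have h1 : |θ * y| ≤ Real.pi := by
              rw [abs_mul, abs_of_pos h0]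
              have := hθ.2
              rw [le_div_iff₀ hy] at this
              linarith [Real.pi_gt_three]
            have := Real.cos_le_one_sub_mul_cos_sq h1
            linarith
        _ ≤ _ := lintegral_mono_set (Ioc_subset_Ioc_right hle)
    refine le_trans (le_of_eq ?_) (mul_le_mul_right hlow _)
    rw [← ENNReal.ofReal_mul (by positivity), ← ENNReal.ofReal_mul (by positivity), ← sq_abs y]
    congr 1
    have := Real.pi_ne_zero
    field_simp

end Tonelli

section Stationary

variable (S : AffineSemigroup)

lemma ofReal_trunc_div_sq {μ : Measure (ℝ × ℝ)} (hμ : ∀ᵐ z ∂μ, 0 ≤ z.1)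
    (hw : Integrable weight μ) (a θ : ℝ) :
    ENNReal.ofReal (trunc μ a / θ ^ 2)
      = ∫⁻ z : ℝ × ℝ, ENNReal.ofReal (min ((a * z.1) ^ 2) 1 / θ ^ 2) ∂μ := by
  rw [trunc, ← integral_div, ofReal_integral_eq_lintegral_ofReal
    ((integrable_min_sq hμ hw a).div_const _) (ae_of_all _ fun z => by positivity)]

lemma lintegral_dominant_lt_top [SigmaFinite S.m] [SigmaFinite S.n]
    (hm : ∀ᵐ z ∂S.m, 0 ≤ z.1) (hmw : Integrable weight S.m) (hn : ∀ᵐ z ∂S.n, 0 ≤ z.1)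
    (hnw : Integrable weight S.n) {c K θ₀ : ℝ} (hc : 0 < c) (hK : 1 ≤ K) (hθ₀ : 0 ≤ θ₀)
    (hθ₁ : θ₀ ≤ 1) :
    ∫⁻ θ in Ioc 0 θ₀, ∫⁻ s in Ioi (0:ℝ), ENNReal.ofReal (dominant S c K θ s / θ ^ 2) < ⊤ := by
  have hmeas (μ : Measure (ℝ × ℝ)) [SigmaFinite μ] : Measurable fun x : ℝ × ℝ =>
      ∫⁻ z : ℝ × ℝ, ENNReal.ofReal
        (min ((K * (x.1 * Real.exp (-c * x.2)) * z.1) ^ 2) 1 / x.1 ^ 2) ∂μ :=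
    Measurable.lintegral_prod_right' (f := fun y : (ℝ × ℝ) × (ℝ × ℝ) => ENNReal.ofReal
      (min ((K * (y.1.1 * Real.exp (-c * y.1.2)) * y.2.1) ^ 2) 1 / y.1.1 ^ 2)) (by fun_prop)
  have hmeas₁ (μ : Measure (ℝ × ℝ)) [SigmaFinite μ] : Measurable fun θ : ℝ =>
      ∫⁻ s in Ioi (0:ℝ), ∫⁻ z : ℝ × ℝ, ENNReal.ofReal
        (min ((K * (θ * Real.exp (-c * s)) * z.1) ^ 2) 1 / θ ^ 2) ∂μ :=
    (hmeas μ).lintegral_prod_right'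
  have hbound : ∀ θ ∈ Ioc 0 θ₀,
      ∫⁻ s in Ioi (0:ℝ), ENNReal.ofReal (dominant S c K θ s / θ ^ 2)
      ≤ (∫⁻ s in Ioi (0:ℝ), ENNReal.ofReal (Real.exp (-c * s)))
        + (∫⁻ s in Ioi (0:ℝ), ∫⁻ z : ℝ × ℝ, ENNReal.ofReal
            (min ((K * (θ * Real.exp (-c * s)) * z.1) ^ 2) 1 / θ ^ 2) ∂S.m)
        + ∫⁻ s in Ioi (0:ℝ), ∫⁻ z : ℝ × ℝ, ENNReal.ofReal
            (min ((K * (θ * Real.exp (-c * s)) * z.1) ^ 2) 1 / θ ^ 2) ∂S.n := by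
    intro θ hθ
    have hθ0 : 0 < θ := hθ.1
    have hmeas₂ : Measurable fun s : ℝ => ∫⁻ z : ℝ × ℝ, ENNReal.ofReal
        (min ((K * (θ * Real.exp (-c * s)) * z.1) ^ 2) 1 / θ ^ 2) ∂S.n :=
      Measurable.lintegral_prod_right' (f := fun y : ℝ × (ℝ × ℝ) => ENNReal.ofReal
        (min ((K * (θ * Real.exp (-c * y.1)) * y.2.1) ^ 2) 1 / θ ^ 2)) (by fun_prop)
    rw [← lintegral_add_left (by fun_prop), ← lintegral_add_right _ hmeas₂]
    refine setLIntegral_mono' measurableSet_Ioi fun s hs => ?_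
    rw [← ofReal_trunc_div_sq hm hmw, ← ofReal_trunc_div_sq hn hnw, dominant, add_div, add_div]
    refine ENNReal.ofReal_add_le.trans (add_le_add (ENNReal.ofReal_add_le.trans
      (add_le_add (ENNReal.ofReal_le_ofReal ?_) le_rfl)) le_rfl)
    have h1 : (θ * Real.exp (-c * s)) ^ 2 / θ ^ 2 = Real.exp (-c * s) ^ 2 := by field_simp
    have h2 : Real.exp (-c * s) ≤ 1 := Real.exp_le_one_iff.2 (by nlinarith [mem_Ioi.1 hs])
    rw [h1]
    nlinarith [Real.exp_pos (-c * s)]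
  refine (setLIntegral_mono' measurableSet_Ioc hbound).trans_lt ?_
  rw [lintegral_add_right _ (hmeas₁ S.n),
    lintegral_add_right _ (hmeas₁ S.m), setLIntegral_const]
  exact ENNReal.add_lt_top.2 ⟨ENNReal.add_lt_top.2
    ⟨ENNReal.mul_lt_top (lintegral_exp_neg_lt_top hc) measure_Ioc_lt_top,
      lintegral_min_sq_lt_top hm hmw hc hK hθ₀ hθ₁⟩,
    lintegral_min_sq_lt_top hn hnw hc hK hθ₀ hθ₁⟩

lemma one_sub_re_exp_le {w : ℂ} (hw : w.re ≤ 0) :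
    1 - (Complex.exp w).re ≤ -w.re + ‖w‖ ^ 2 := by
  rw [Complex.exp_re]
  have h1 := Real.add_one_le_exp w.re
  have h2 : Real.exp w.re * (1 - Real.cos w.im) ≤ 1 * (1 - Real.cos w.im) :=
    mul_le_mul_of_nonneg_right (Real.exp_le_one_iff.2 hw) (by linarith [Real.cos_le_one w.im])
  have h3 := Real.one_sub_sq_div_two_le_cos (x := w.im)
  have h4 : w.im ^ 2 ≤ ‖w‖ ^ 2 := sq_le_sq' (abs_le.1 (Complex.abs_im_le_norm w)).1
    (abs_le.1 (Complex.abs_im_le_norm w)).2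
  nlinarith [sq_nonneg w.im]

lemma one_sub_re_exp_add_le {v w : ℂ} (hv : v.re ≤ 0) (hw : w.re ≤ 0) :
    1 - (Complex.exp (v + w)).re ≤ (1 - (Complex.exp w).re) + min 2 ‖v‖ := by
  have h : Complex.exp w - Complex.exp (v + w) = -(Complex.exp w * (Complex.exp v - 1)) := by
    rw [Complex.exp_add]; ring
  have h1 := Complex.re_le_norm (Complex.exp w - Complex.exp (v + w))
  rw [h, norm_neg, norm_mul, ← h, Complex.sub_re] at h1
  have h2 : ‖Complex.exp w‖ * ‖Complex.exp v - 1‖ ≤ 1 * min 2 ‖v‖ :=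
    mul_le_mul (norm_exp_le_one_of_re_nonpos hw)
      (le_min (norm_exp_sub_one_le_two_of_re_nonpos hv) (norm_exp_sub_one_le_of_re_nonpos hv))
      (norm_nonneg _) zero_le_one
  linarith

lemma lintegral_one_sub_cos_transition (θ : ℝ) {T : ℝ} (hT : 0 ≤ T) {x : ℝ × ℝ} (hx : 0 ≤ x.1) :
    ∫⁻ y : ℝ × ℝ, ENNReal.ofReal (1 - Real.cos (θ * y.2)) ∂(S.P T x)
      = ENNReal.ofReal (1 - (Complex.exp ((x.1 : ℂ) * riccati S θ T
        + (x.2 : ℂ) * (((θ * Real.exp (-S.b₂ * T) : ℝ) : ℂ) * Complex.I)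
        + cumulant S θ T)).re) := by
  have := S.P_prob T hT x hx
  have hchar := S.P_char T hT x hx (0, (θ : ℂ) * Complex.I) (by simp) (by simp)
  simp only [exp_mul_mul_I] at hchar
  change _ = Complex.exp ((x.1 : ℂ) * riccati S θ T
        + (x.2 : ℂ) * (((θ * Real.exp (-S.b₂ * T) : ℝ) : ℂ) * Complex.I)
        + cumulant S θ T) at hchar
  rw [← hchar]
  have hI : Integrable (fun y : ℝ × ℝ => Complex.exp (0 * (y.1 : ℂ)
      + (θ : ℂ) * Complex.I * (y.2 : ℂ))) (S.P T x) := by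
    refine (integrable_const (1 : ℝ)).mono' (by fun_prop) (ae_of_all _ fun y => ?_)
    exact norm_exp_le_one_of_re_nonpos (by simp)
  have hre : (∫ y : ℝ × ℝ, Complex.exp (0 * (y.1 : ℂ) + (θ : ℂ) * Complex.I * (y.2 : ℂ))
      ∂(S.P T x)).re = ∫ y : ℝ × ℝ, Real.cos (θ * y.2) ∂(S.P T x) := by
    rw [← RCLike.re_eq_complex_re, ← integral_re hI]
    congr 1 with y
    rw [RCLike.re_eq_complex_re, Complex.exp_re]
    simp
  have hcos : Integrable (fun y : ℝ × ℝ => Real.cos (θ * y.2)) (S.P T x) :=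
    (integrable_const (1 : ℝ)).mono' (by fun_prop) (ae_of_all _ fun y => Real.abs_cos_le_one _)
  have hsub : Integrable (fun y : ℝ × ℝ => 1 - Real.cos (θ * y.2)) (S.P T x) :=
    (integrable_const 1).sub hcos
  rw [hre, ← ofReal_integral_eq_lintegral_ofReal hsub
    (ae_of_all _ fun y => sub_nonneg.2 (Real.cos_le_one _)), integral_sub (integrable_const 1) hcos]
  simp

variable {S} {π : Measure (ℝ × ℝ)}

lemma lintegral_one_sub_cos_stationary_le (hπ : IsStationary S.P π)
    (hn : ∀ᵐ z ∂S.n, 0 ≤ z.1) {c K θ : ℝ} (hc : 0 < c) (hcb : c ≤ S.b₂) (hK : 1 ≤ K)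
    (hθ : 0 ≤ θ)
    (hV : ∀ t, 0 ≤ t → ‖riccati S θ t‖ ≤ K * (θ * Real.exp (-c * t))) {β : ℝ≥0∞}
    (hβ : ∀ T, 0 ≤ T → ENNReal.ofReal (1 - (Complex.exp (cumulant S θ T)).re) ≤ β) :
    ∫⁻ y : ℝ × ℝ, ENNReal.ofReal (1 - Real.cos (θ * y.2)) ∂π ≤ β := by
  have := hπ.1
  set g : ℕ → ℝ × ℝ → ℝ≥0∞ := fun k x =>
    ENNReal.ofReal (min 2 ((|x.1| + |x.2|) * (K * (θ * Real.exp (-c * k))))) with hg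
  have hgmeas (k : ℕ) : Measurable (g k) := by fun_prop
  have hstep (k : ℕ) : ∫⁻ y : ℝ × ℝ, ENNReal.ofReal (1 - Real.cos (θ * y.2)) ∂π
      ≤ β + ∫⁻ x, g k x ∂π := by
    have hk : (0 : ℝ) ≤ k := k.cast_nonneg
    calc _ = ∫⁻ y : ℝ × ℝ, ENNReal.ofReal (1 - Real.cos (θ * y.2)) ∂(π.bind (S.P k)) := by
          rw [hπ.2.2 k hk]
      _ = ∫⁻ x, ∫⁻ y : ℝ × ℝ, ENNReal.ofReal (1 - Real.cos (θ * y.2)) ∂(S.P k x) ∂π :=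
          Measure.lintegral_bind (S.P_meas k hk).aemeasurable (by fun_prop)
      _ ≤ ∫⁻ x, (β + g k x) ∂π := by
          refine lintegral_mono_ae ?_
          have hsupp : ∀ᵐ x ∂π, 0 ≤ x.1 :=
            measure_mono_null (fun x (hx : ¬ 0 ≤ x.1) => not_le.1 hx) hπ.2.1
          filter_upwards [hsupp] with x hx
          rw [lintegral_one_sub_cos_transition S θ hk hx]
          set v := (x.1 : ℂ) * riccati S θ k
            + (x.2 : ℂ) * (((θ * Real.exp (-S.b₂ * k) : ℝ) : ℂ) * Complex.I) with hv
          have hvre : v.re ≤ 0 := by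
            have h := mul_nonpos_of_nonneg_of_nonpos hx (riccati_re_nonpos S θ hk)
            rw [hv, Complex.add_re, Complex.re_ofReal_mul, Complex.re_ofReal_mul,
              Complex.re_ofReal_mul]
            simpa using h
          have hvn : ‖v‖ ≤ (|x.1| + |x.2|) * (K * (θ * Real.exp (-c * k))) := by
            have h1 : ‖((θ * Real.exp (-S.b₂ * k) : ℝ) : ℂ) * Complex.I‖
                ≤ K * (θ * Real.exp (-c * k)) := by
              rw [norm_mul, Complex.norm_I, mul_one, Complex.norm_real,
                Real.norm_of_nonneg (by positivity)]
              have h2 : θ * Real.exp (-S.b₂ * k) ≤ θ * Real.exp (-c * k) :=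
                mul_le_mul_of_nonneg_left (Real.exp_le_exp.2 (by nlinarith)) hθ
              exact h2.trans (le_mul_of_one_le_left (by positivity) hK)
            refine (norm_add_le _ _).trans ?_
            rw [norm_mul, norm_mul (x.2 : ℂ), Complex.norm_real, Complex.norm_real, add_mul]
            exact add_le_add (mul_le_mul_of_nonneg_left (hV k hk) (norm_nonneg _))
              (mul_le_mul_of_nonneg_left h1 (norm_nonneg _))
          refine (ENNReal.ofReal_le_ofReal
            (one_sub_re_exp_add_le hvre (cumulant_re_nonpos S hn θ hk))).trans ?_
          exact ENNReal.ofReal_add_le.trans (add_le_add (hβ k hk)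
            (ENNReal.ofReal_le_ofReal (min_le_min le_rfl hvn)))
      _ = β + ∫⁻ x, g k x ∂π := by
          rw [lintegral_add_left measurable_const, lintegral_const, measure_univ, mul_one]
  have hexp : Tendsto (fun k : ℕ => Real.exp (-c * k)) atTop (𝓝 0) := by
    refine Real.tendsto_exp_atBot.comp ?_
    exact tendsto_natCast_atTop_atTop.const_mul_atTop_of_neg (neg_lt_zero.2 hc)
  have hlim : Tendsto (fun k => ∫⁻ x, g k x ∂π) atTop (𝓝 (∫⁻ _, 0 ∂π)) := by
    refine tendsto_lintegral_of_dominated_convergence (fun _ => ENNReal.ofReal 2) hgmeas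
      (fun k => ae_of_all _ fun x => ENNReal.ofReal_le_ofReal (min_le_left _ _)) (by simp)
      (ae_of_all _ fun x => ?_)
    have h := ((hexp.const_mul θ).const_mul K).const_mul (|x.1| + |x.2|)
    have h2 := ENNReal.tendsto_ofReal ((tendsto_const_nhds (x := (2 : ℝ))).min h)
    simp only [mul_zero, min_eq_right (zero_le_two : (0 : ℝ) ≤ 2), ENNReal.ofReal_zero] at h2
    exact h2
  rw [lintegral_zero] at hlim
  have := hlim.const_add β
  rw [add_zero] at this
  exact ge_of_tendsto' this hstep

end Stationary

section Integrability

variable (S : AffineSemigroup)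

lemma integrable_weight_m : Integrable weight S.m := by
  have hm := ae_nonneg_of_null S.m_supp
  refine ⟨measurable_weight.aestronglyMeasurable, ?_⟩
  rw [hasFiniteIntegral_iff_ofReal (hm.mono fun z hz => weight_nonneg hz)]
  exact S.m_int

lemma integrable_fst_n
    (hz₁ : ∫⁻ z in {z : ℝ × ℝ | 1 < z.1}, ENNReal.ofReal z.1 ∂S.n < ⊤) :
    Integrable (fun z : ℝ × ℝ => z.1) S.n := by
  have hn := ae_nonneg_of_null S.n_supp
  refine ⟨by fun_prop, ?_⟩
  rw [hasFiniteIntegral_iff_ofReal hn]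
  have hmeas : MeasurableSet {z : ℝ × ℝ | 1 < z.1} := measurableSet_lt (by fun_prop) (by fun_prop)
  rw [← lintegral_add_compl _ hmeas]
  refine ENNReal.add_lt_top.2 ⟨hz₁, lt_of_le_of_lt ?_ S.n_int⟩
  refine (setLIntegral_mono' hmeas.compl fun z hz => ENNReal.ofReal_le_ofReal ?_).trans
    (setLIntegral_le_lintegral _ _)
  have h1 : z.1 ≤ 1 := not_lt.1 hz
  rw [min_eq_right h1]
  have : 0 ≤ min |z.2| (z.2 ^ 2) := by positivity
  linarith

lemma integrable_weight_n
    (hz₁ : ∫⁻ z in {z : ℝ × ℝ | 1 < z.1}, ENNReal.ofReal z.1 ∂S.n < ⊤)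
    (hz₂ : ∫⁻ z : ℝ × ℝ, ENNReal.ofReal (z.2 ^ 2) ∂S.n < ⊤) : Integrable weight S.n := by
  have hsq : Integrable (fun z : ℝ × ℝ => z.2 ^ 2) S.n := by
    refine ⟨by fun_prop, ?_⟩
    rw [hasFiniteIntegral_iff_ofReal (ae_of_all _ fun z => sq_nonneg _)]
    exact hz₂
  refine ((integrable_fst_n S hz₁).add hsq).mono' measurable_weight.aestronglyMeasurable ?_
  filter_upwards [ae_nonneg_of_null S.n_supp] with z hz
  rw [Real.norm_of_nonneg (weight_nonneg hz)]
  exact add_le_add (min_le_left _ _) le_rfl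

end Integrability

/-- Finite first absolute moment of the stationary distribution in the second
coordinate. -/
theorem stationary_second_coordinate_moment_finite
    (S : AffineSemigroup) (π : Measure (ℝ × ℝ))
    (ha₁ : 0 < S.a₁) (hb₂ : 0 < S.b₂)
    (hz₁ : ∫⁻ z in {z : ℝ × ℝ | 1 < z.1}, ENNReal.ofReal z.1 ∂S.n < ⊤)
    (hz₂ : ∫⁻ z : ℝ × ℝ, ENNReal.ofReal (z.2 ^ 2) ∂S.n < ⊤)
    (hπ : IsStationary S.P π)
    (huniq : ∀ π' : Measure (ℝ × ℝ), IsStationary S.P π' → π' = π) :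
    ∫⁻ y : ℝ × ℝ, ENNReal.ofReal |y.2| ∂π < ⊤ := by
  have hm := ae_nonneg_of_null S.m_supp
  have hn := ae_nonneg_of_null S.n_supp
  have hmw := integrable_weight_m S
  have hn1 := integrable_fst_n S hz₁
  have hnw := integrable_weight_n S hz₁ hz₂
  have := sigmaFinite_of_integrable_weight S.m_supp hmw
  have := sigmaFinite_of_integrable_weight S.n_supp hnw
  have := hπ.1
  obtain ⟨c, K, θ₀, hc, hcb, hK, hθ₀, hθ₁, hV⟩ := exists_norm_riccati_le S ha₁ hb₂ hm hmw
  obtain ⟨C₁, hC₁, hcum⟩ := exists_norm_cumulant_le S hn hnw hn1 hc hcb hK hθ₁ hV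
  obtain ⟨C₂, hC₂, hre⟩ :=
    exists_neg_re_cumulant_le S ha₁ hm hmw hn hnw hn1 hc hcb hK hV
  set B : ℝ → ℝ≥0∞ := fun θ =>
    ∫⁻ s in Ioi (0:ℝ), ENNReal.ofReal (dominant S c K θ s / θ ^ 2) with hB
  have hBfin : ∫⁻ θ in Ioc 0 θ₀, B θ < ⊤ :=
    lintegral_dominant_lt_top S hm hmw hn hnw hc hK hθ₀.le hθ₁
  have hcos : ∀ θ ∈ Ioc 0 θ₀,
      ∫⁻ y : ℝ × ℝ, ENNReal.ofReal ((1 - Real.cos (θ * y.2)) / θ ^ 2) ∂π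
        ≤ ENNReal.ofReal C₂ * B θ + ENNReal.ofReal (C₁ ^ 2) := by
    intro θ hθ
    have hθ0 : 0 < θ := hθ.1
    have hβ (T : ℝ) (hT : 0 ≤ T) :
        ENNReal.ofReal (1 - (Complex.exp (cumulant S θ T)).re)
          ≤ ENNReal.ofReal (θ ^ 2) * (ENNReal.ofReal C₂ * B θ + ENNReal.ofReal (C₁ ^ 2)) := by
      have h1 := one_sub_re_exp_le (cumulant_re_nonpos S hn θ hT)
      have h2 := pow_le_pow_left₀ (norm_nonneg _) (hcum θ hθ0.le hθ.2 T hT) 2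
      have h3 := hre θ hθ0.le hθ.2 T hT
      have h4 : ∫ s in (0:ℝ)..T, dominant S c K θ s
          = θ ^ 2 * ∫ s in (0:ℝ)..T, dominant S c K θ s / θ ^ 2 := by
        rw [intervalIntegral.integral_div]
        field_simp
      have h5 : ENNReal.ofReal (∫ s in (0:ℝ)..T, dominant S c K θ s / θ ^ 2) ≤ B θ := by
        rw [intervalIntegral.integral_of_le hT, ofReal_integral_eq_lintegral_ofReal]
        · exact lintegral_mono_set Ioc_subset_Ioi_self
        · exact (intervalIntegrable_iff_integrableOn_Ioc_of_le hT).1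
            ((antitone_dominant S hm hmw hn hnw hc hK hθ0.le).intervalIntegrable.div_const _)
        · exact ae_of_all _ fun s => div_nonneg (dominant_nonneg S c K θ s) (sq_nonneg θ)
      calc _ ≤ ENNReal.ofReal (θ ^ 2 *
            (C₂ * (∫ s in (0:ℝ)..T, dominant S c K θ s / θ ^ 2) + C₁ ^ 2)) := by
            refine ENNReal.ofReal_le_ofReal ?_
            rw [h4] at h3
            linarith
        _ ≤ _ := by
            rw [ENNReal.ofReal_mul (sq_nonneg θ)]
            refine mul_le_mul_right (ENNReal.ofReal_add_le.trans (add_le_add ?_ le_rfl)) _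
            rw [ENNReal.ofReal_mul hC₂]
            exact mul_le_mul_right h5 _
    have h := lintegral_one_sub_cos_stationary_le hπ hn hc hcb hK hθ0.le (hV θ hθ0.le hθ.2) hβ
    have heq : ∫⁻ y : ℝ × ℝ, ENNReal.ofReal ((1 - Real.cos (θ * y.2)) / θ ^ 2) ∂π
        = (∫⁻ y : ℝ × ℝ, ENNReal.ofReal (1 - Real.cos (θ * y.2)) ∂π) / ENNReal.ofReal (θ ^ 2) := by
      simp_rw [ENNReal.ofReal_div_of_pos (show 0 < θ ^ 2 by positivity), div_eq_mul_inv]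
      rw [lintegral_mul_const _ (by fun_prop)]
    rw [heq]
    exact ENNReal.div_le_of_le_mul' h
  have hfin : ∫⁻ θ in Ioc 0 θ₀, ∫⁻ y : ℝ × ℝ,
      ENNReal.ofReal ((1 - Real.cos (θ * y.2)) / θ ^ 2) ∂π < ⊤ := by
    refine (setLIntegral_mono' measurableSet_Ioc hcos).trans_lt ?_
    rw [lintegral_add_right _ measurable_const, lintegral_const_mul' _ _ ENNReal.ofReal_ne_top,
      setLIntegral_const]
    exact ENNReal.add_lt_top.2 ⟨ENNReal.mul_lt_top ENNReal.ofReal_lt_top hBfin,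
      ENNReal.mul_lt_top ENNReal.ofReal_lt_top measure_Ioc_lt_top⟩
  rw [lintegral_lintegral_swap (by fun_prop)] at hfin
  refine (lintegral_mono fun y : ℝ × ℝ => le_lintegral_one_sub_cos hθ₀ y.2).trans_lt ?_
  rw [lintegral_add_left measurable_const, lintegral_const_mul' _ _ ENNReal.ofReal_ne_top,
    lintegral_const, measure_univ, mul_one]
  exact ENNReal.add_lt_top.2
    ⟨ENNReal.ofReal_lt_top, ENNReal.mul_lt_top ENNReal.ofReal_lt_top hfin⟩

end AffinePaper
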